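/- arXiv:1506.05517 — 5 statements merged into one kernel-verified Lean document; each statement's English description precedes it below -/
import Mathlib

section
/- J_4 is a characteristic subgroup of B'_4: for every automorphism φ of B'_4 and every x ∈ B'_4 with x ∈ J_4, one has φ(x) ∈ J_4. -/
/-- Relators of the Artin presentation of the braid group on `n` strings:
generators `σ_0, …, σ_{n-2}` (0-based), with `σ_i σ_j = σ_j σ_i` for `|i-j| > 1`
and `σ_i σ_j σ_i = σ_j σ_i σ_j` for `|i-j| = 1`. -/
def braidRels (n : ℕ) : Set (FreeGroup (Fin (n - 1))) :=
  {r | (∃ i j : Fin (n - 1), (i : ℕ) + 2 ≤ (j : ℕ) ∧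
          r = FreeGroup.of i * FreeGroup.of j * (FreeGroup.of i)⁻¹ * (FreeGroup.of j)⁻¹) ∨
       (∃ i j : Fin (n - 1), (j : ℕ) = (i : ℕ) + 1 ∧
          r = FreeGroup.of i * FreeGroup.of j * FreeGroup.of i *
              (FreeGroup.of j * FreeGroup.of i * FreeGroup.of j)⁻¹)}

/-- The braid group `B_n`, presented by Artin generators and relations. -/
abbrev BraidGroup (n : ℕ) := PresentedGroup (braidRels n)

/-- The Artin generator `σ_{i+1}` (1-based), i.e. `σ i` for `i : Fin (n-1)` (0-based). -/
def σ {n : ℕ} (i : Fin (n - 1)) : BraidGroup n := PresentedGroup.of i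

section BraidRelations

open scoped commutatorElement

variable {G : Type*} [Group G] {a b c : G}

lemma inv_mul_inv_mul_of_braid (h : a * b * a = b * a * b) :
    a⁻¹ * b⁻¹ * a = b * a⁻¹ * b⁻¹ := by
  calc a⁻¹ * b⁻¹ * a = a⁻¹ * b⁻¹ * (a * b * a) * a⁻¹ * b⁻¹ := by group
    _ = b * a⁻¹ * b⁻¹ := by rw [h]; group

lemma mul_inv_mem_commutator_of_braid (h : a * b * a = b * a * b) :
    b * a⁻¹ ∈ commutator G := by
  have : b * a⁻¹ = ⁅a * b, a⁆ := by
    rw [commutatorElement_def, h]; group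
  rw [this]
  exact Subgroup.commutator_mem_commutator (Subgroup.mem_top _) (Subgroup.mem_top _)

lemma conj_mul_inv_of_braid (h : a * b * a = b * a * b) :
    a * (b * a⁻¹) * a⁻¹ = (a⁻¹ * b)⁻¹ * (b * a⁻¹) := by
  calc a * (b * a⁻¹) * a⁻¹ = b⁻¹ * (b * a * b) * a⁻¹ * a⁻¹ := by group
    _ = (a⁻¹ * b)⁻¹ * (b * a⁻¹) := by rw [← h]; group

lemma inv_conj_conj_of_braid (h₁ : a * b * a = b * a * b) (h₂ : b * c * b = c * b * c)
    (h₃ : a * c = c * a) :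
    a⁻¹ * (b * (c * a⁻¹) * b⁻¹) * a = c * a⁻¹ * (b * (c * a⁻¹) * b⁻¹) := by
  have e : a⁻¹ * c = c * a⁻¹ := ((show Commute a c from h₃).inv_left).eq
  calc a⁻¹ * (b * (c * a⁻¹) * b⁻¹) * a = a⁻¹ * b * c * (a⁻¹ * b⁻¹ * a) := by group
    _ = a⁻¹ * (b * c * b) * a⁻¹ * b⁻¹ := by rw [inv_mul_inv_mul_of_braid h₁]; group
    _ = (a⁻¹ * c) * b * c * a⁻¹ * b⁻¹ := by rw [h₂]; group
    _ = c * a⁻¹ * (b * (c * a⁻¹) * b⁻¹) := by rw [e]; group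

lemma conj_mul_inv_of_commute (h₃ : a * c = c * a) : a * (c * a⁻¹) * a⁻¹ = c * a⁻¹ := by
  rw [← mul_assoc, h₃]; group

lemma conj_conj_of_braid (h₁ : a * b * a = b * a * b) (h₂ : b * c * b = c * b * c)
    (h₃ : a * c = c * a) :
    b * (b * (c * a⁻¹) * b⁻¹) * b⁻¹ =
      b * (c * a⁻¹) * b⁻¹ * (c * a⁻¹)⁻¹ * (b * (c * a⁻¹) * b⁻¹) := by
  have key := inv_conj_conj_of_braid h₁ h₂ h₃
  have hd := conj_mul_inv_of_commute h₃
  generalize c * a⁻¹ = d at *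
  have key' : a * (b * d * b⁻¹) * a⁻¹ = d⁻¹ * (b * d * b⁻¹) := by
    calc a * (b * d * b⁻¹) * a⁻¹ = (a * d * a⁻¹)⁻¹ * (a * (d * (b * d * b⁻¹)) * a⁻¹) := by group
      _ = d⁻¹ * (b * d * b⁻¹) := by rw [← key, hd]; group
  calc b * (b * d * b⁻¹) * b⁻¹
      = b * d * b⁻¹ * (b * (d⁻¹ * (b * d * b⁻¹)) * b⁻¹) := by group
    _ = b * d * b⁻¹ * ((b * a * b) * d * (b * a * b)⁻¹) := by rw [← key']; group
    _ = b * d * b⁻¹ * (a * (b * (a * d * a⁻¹) * b⁻¹) * a⁻¹) := by rw [← h₁]; group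
    _ = b * d * b⁻¹ * d⁻¹ * (b * d * b⁻¹) := by rw [hd, key']; group

end BraidRelations

lemma σ_braid_zero_one : (σ 0 * σ 1 * σ 0 : BraidGroup 4) = σ 1 * σ 0 * σ 1 :=
  mul_inv_eq_one.mp <| PresentedGroup.one_of_mem (rels := braidRels 4)
    (Or.inr ⟨0, 1, rfl, rfl⟩)

lemma σ_braid_one_two : (σ 1 * σ 2 * σ 1 : BraidGroup 4) = σ 2 * σ 1 * σ 2 :=
  mul_inv_eq_one.mp <| PresentedGroup.one_of_mem (rels := braidRels 4)
    (Or.inr ⟨1, 2, rfl, rfl⟩)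

lemma σ_comm_zero_two : (σ 0 * σ 2 : BraidGroup 4) = σ 2 * σ 0 := by
  have : (σ 0 * σ 2 * (σ 0)⁻¹ * (σ 2)⁻¹ : BraidGroup 4) = 1 :=
    PresentedGroup.one_of_mem (rels := braidRels 4) (Or.inl ⟨0, 2, le_rfl, rfl⟩)
  rwa [mul_assoc, ← mul_inv_rev, mul_inv_eq_one] at this

lemma exists_hom_braidGroup_four {G : Type*} [Group G] {a b c : G} (h₁ : a * b * a = b * a * b)
    (h₂ : b * c * b = c * b * c) (h₃ : a * c = c * a) :
    ∃ F : BraidGroup 4 →* G, F (σ 0) = a ∧ F (σ 1) = b ∧ F (σ 2) = c := by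
  have h : ∀ r ∈ braidRels 4, FreeGroup.lift (![a, b, c] : Fin (4 - 1) → G) r = 1 := by
    rintro r (⟨i, j, hij, rfl⟩ | ⟨i, j, hij, rfl⟩) <;> fin_cases i <;> fin_cases j <;>
      simp at hij <;> simp [h₁, h₂, h₃]
  exact ⟨PresentedGroup.toGroup h, PresentedGroup.toGroup.of h, PresentedGroup.toGroup.of h,
    PresentedGroup.toGroup.of h⟩

lemma mem_of_σ_mem {N : Subgroup (BraidGroup 4)} (h₀ : σ 0 ∈ N) (h₁ : σ 1 ∈ N) (h₂ : σ 2 ∈ N)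
    (x : BraidGroup 4) : x ∈ N := by
  refine PresentedGroup.generated_by _ _ (fun j ↦ ?_) x
  fin_cases j
  exacts [h₀, h₁, h₂]

/-- The commutator subgroup of the braid group on four strings. -/
abbrev BraidCommutator : Type := ↥(commutator (BraidGroup 4))

namespace BraidCommutator

/-- The element `σ₂ σ₁⁻¹` of `B'_4`. -/
def u : BraidCommutator :=
  ⟨σ 1 * (σ 0)⁻¹, mul_inv_mem_commutator_of_braid σ_braid_zero_one⟩

/-- The element `σ₁⁻¹ σ₂` of `B'_4`. -/
def t : BraidCommutator :=
  ⟨(σ 0)⁻¹ * σ 1, by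
    have h := (inferInstance : (commutator (BraidGroup 4)).Normal).conj_mem _ u.2 (σ 0)⁻¹
    simpa [u, mul_assoc] using h⟩

/-- The element `σ₃ σ₁⁻¹` of `B'_4`. -/
def c : BraidCommutator :=
  ⟨σ 2 * (σ 0)⁻¹, by
    simpa [u, mul_assoc] using mul_mem (mul_inv_mem_commutator_of_braid σ_braid_one_two) u.2⟩

/-- The conjugate of `σ₃ σ₁⁻¹` by `σ₂`. -/
def w : BraidCommutator := u * c * u⁻¹

lemma coe_w : (w : BraidGroup 4) = σ 1 * (σ 2 * (σ 0)⁻¹) * (σ 1)⁻¹ := by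
  have h := conj_mul_inv_of_commute σ_comm_zero_two
  calc (w : BraidGroup 4)
      = σ 1 * ((σ 0)⁻¹ * (σ 2 * (σ 0)⁻¹) * σ 0) * (σ 1)⁻¹ := by
        simp only [w, u, c, Subgroup.coe_mul, Subgroup.coe_inv]; group
    _ = σ 1 * (σ 2 * (σ 0)⁻¹) * (σ 1)⁻¹ := by nth_rw 1 [← h]; group

lemma u_mul_c : u * c = w * u := by simp [w]

lemma u_mul_w : u * w = w * w * c⁻¹ * w * u := by
  have key := inv_conj_conj_of_braid σ_braid_zero_one σ_braid_one_two σ_comm_zero_two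
  have key' := conj_conj_of_braid σ_braid_zero_one σ_braid_one_two σ_comm_zero_two
  apply Subtype.ext
  simp only [Subgroup.coe_mul, Subgroup.coe_inv, coe_w]
  simp only [u, c]
  generalize (σ 2 * (σ 0)⁻¹ : BraidGroup 4) = d at *
  calc σ 1 * (σ 0)⁻¹ * (σ 1 * d * (σ 1)⁻¹)
      = σ 1 * ((σ 0)⁻¹ * (σ 1 * d * (σ 1)⁻¹) * σ 0) * (σ 0)⁻¹ := by group
    _ = σ 1 * d * (σ 1)⁻¹ * (σ 1 * (σ 1 * d * (σ 1)⁻¹) * (σ 1)⁻¹) * (σ 1 * (σ 0)⁻¹) := by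
        rw [key]; group
    _ = _ := by rw [key']; group

lemma t_mul_c : t * c = c * w * t := by
  have key := inv_conj_conj_of_braid σ_braid_zero_one σ_braid_one_two σ_comm_zero_two
  apply Subtype.ext
  simp only [Subgroup.coe_mul, coe_w]
  simp only [t, c]
  rw [← key]; group

lemma t_mul_w : t * w = c * w * w * t := by
  have key := inv_conj_conj_of_braid σ_braid_zero_one σ_braid_one_two σ_comm_zero_two
  have key' := conj_conj_of_braid σ_braid_zero_one σ_braid_one_two σ_comm_zero_two
  have hd := conj_mul_inv_of_commute σ_comm_zero_two
  apply Subtype.ext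
  simp only [Subgroup.coe_mul, coe_w]
  simp only [t, c]
  generalize (σ 2 * (σ 0)⁻¹ : BraidGroup 4) = d at *
  calc (σ 0)⁻¹ * σ 1 * (σ 1 * d * (σ 1)⁻¹)
      = (σ 0)⁻¹ * (σ 1 * (σ 1 * d * (σ 1)⁻¹) * (σ 1)⁻¹) * σ 1 := by group
    _ = ((σ 0)⁻¹ * (σ 1 * d * (σ 1)⁻¹) * σ 0) * ((σ 0)⁻¹ * d * σ 0)⁻¹ *
          ((σ 0)⁻¹ * (σ 1 * d * (σ 1)⁻¹) * σ 0) * ((σ 0)⁻¹ * σ 1) := by rw [key']; group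
    _ = d * (σ 1 * d * (σ 1)⁻¹) * ((σ 0)⁻¹ * (σ 0 * d * (σ 0)⁻¹) * σ 0)⁻¹ *
          (d * (σ 1 * d * (σ 1)⁻¹)) * ((σ 0)⁻¹ * σ 1) := by rw [key, hd]
    _ = _ := by group

lemma σ_zero_mem_normalizer {N : Subgroup (BraidGroup 4)}
    (hN : N = Subgroup.closure {(u : BraidGroup 4), (t : BraidGroup 4), (c : BraidGroup 4)}) :
    σ 0 ∈ Subgroup.normalizer (N : Set (BraidGroup 4)) := by
  have hu : (u : BraidGroup 4) ∈ N := hN ▸ Subgroup.subset_closure (by simp)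
  have ht : (t : BraidGroup 4) ∈ N := hN ▸ Subgroup.subset_closure (by simp)
  have hc : (c : BraidGroup 4) ∈ N := hN ▸ Subgroup.subset_closure (by simp)
  have conj_mem {x : BraidGroup 4} (hx : x ∈ N) {g : BraidGroup 4}
      (hgu : g * u * g⁻¹ ∈ N) (hgt : g * t * g⁻¹ ∈ N) (hgc : g * c * g⁻¹ ∈ N) :
      g * x * g⁻¹ ∈ N := by
    have hle : N ≤ N.comap (MulAut.conj g).toMonoidHom := by
      conv_lhs => rw [hN]
      rw [Subgroup.closure_le]
      rintro y (rfl | rfl | rfl)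
      exacts [hgu, hgt, hgc]
    exact hle hx
  have eu : σ 0 * (u : BraidGroup 4) * (σ 0)⁻¹ = (t : BraidGroup 4)⁻¹ * (u : BraidGroup 4) :=
    conj_mul_inv_of_braid σ_braid_zero_one
  have et : σ 0 * (t : BraidGroup 4) * (σ 0)⁻¹ = (u : BraidGroup 4) := by simp [t, u]
  have ec : σ 0 * (c : BraidGroup 4) * (σ 0)⁻¹ = (c : BraidGroup 4) :=
    conj_mul_inv_of_commute σ_comm_zero_two
  rw [Subgroup.mem_normalizer_iff]
  intro x
  refine ⟨fun hx ↦ conj_mem hx ?_ ?_ ?_, fun hx ↦ ?_⟩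
  · rw [eu]; exact mul_mem (inv_mem ht) hu
  · rwa [et]
  · rwa [ec]
  · have h := conj_mem hx (g := (σ 0)⁻¹) ?_ ?_ ?_
    · simpa [mul_assoc] using h
    · rw [← et]; simpa [mul_assoc] using ht
    · have : (σ 0)⁻¹ * (t : BraidGroup 4) * (σ 0)⁻¹⁻¹ =
          (t : BraidGroup 4) * (u : BraidGroup 4)⁻¹ := by
        have h' : (t : BraidGroup 4) =
            σ 0 * ((t : BraidGroup 4) * (u : BraidGroup 4)⁻¹) * (σ 0)⁻¹ := by
          rw [← conj_mul, ← conj_inv, eu, et]; group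
        nth_rw 1 [h']; group
      rw [this]
      exact mul_mem ht (inv_mem hu)
    · rw [← ec]; simpa [mul_assoc] using hc

open scoped commutatorElement in
lemma commutator_le_closure : commutator (BraidGroup 4) ≤
    Subgroup.closure {(u : BraidGroup 4), (t : BraidGroup 4), (c : BraidGroup 4)} := by
  obtain ⟨N, hN⟩ : ∃ N, N = Subgroup.closure
    {(u : BraidGroup 4), (t : BraidGroup 4), (c : BraidGroup 4)} := ⟨_, rfl⟩
  rw [← hN]
  have hu : (u : BraidGroup 4) ∈ N := hN ▸ Subgroup.subset_closure (by simp)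
  have hc : (c : BraidGroup 4) ∈ N := hN ▸ Subgroup.subset_closure (by simp)
  have h0 := σ_zero_mem_normalizer hN
  have h1 : σ 1 = (u : BraidGroup 4) * σ 0 := by simp [u]
  have h2 : σ 2 = (c : BraidGroup 4) * σ 0 := by simp [c]
  have hnormal : N.Normal := by
    rw [← Subgroup.normalizer_eq_top_iff, eq_top_iff]
    rintro x -
    refine mem_of_σ_mem h0 ?_ ?_ x
    · rw [h1]; exact mul_mem (Subgroup.le_normalizer hu) h0
    · rw [h2]; exact mul_mem (Subgroup.le_normalizer hc) h0
  have hcyc (x : BraidGroup 4) :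
      x ∈ (Subgroup.zpowers (QuotientGroup.mk' N (σ 0))).comap (QuotientGroup.mk' N) := by
    have hmul {n : BraidGroup 4} (hn : n ∈ N) :
        QuotientGroup.mk' N (n * σ 0) = QuotientGroup.mk' N (σ 0) := by
      rw [map_mul, QuotientGroup.mk'_apply, (QuotientGroup.eq_one_iff n).mpr hn, one_mul]
    refine mem_of_σ_mem (N := Subgroup.comap _ _) (Subgroup.mem_zpowers _) ?_ ?_ x
    · rw [h1, Subgroup.mem_comap, hmul hu]; exact Subgroup.mem_zpowers _
    · rw [h2, Subgroup.mem_comap, hmul hc]; exact Subgroup.mem_zpowers _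
  rw [commutator_def, Subgroup.commutator_le]
  intro x _ y _
  rw [← QuotientGroup.eq_one_iff, ← QuotientGroup.mk'_apply, map_commutatorElement,
    commutatorElement_eq_one_iff_mul_comm]
  obtain ⟨m, hm⟩ := hcyc x
  obtain ⟨n, hn⟩ := hcyc y
  rw [← hm, ← hn]
  exact zpow_mul_comm _ m n

lemma closure_eq_top : Subgroup.closure {u, t, c} = ⊤ := by
  apply Subgroup.map_injective (commutator (BraidGroup 4)).subtype_injective
  rw [MonoidHom.map_closure, ← MonoidHom.range_eq_map, Subgroup.range_subtype]
  refine le_antisymm ?_ ?_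
  · rw [Subgroup.closure_le]
    rintro _ ⟨x, -, rfl⟩
    exact x.2
  · simpa [Set.image_insert_eq] using commutator_le_closure

lemma hom_ext {H : Type*} [Group H] {F F' : BraidCommutator →* H} (hu : F u = F' u)
    (ht : F t = F' t) (hc : F c = F' c) : F = F' := by
  refine MonoidHom.eq_of_eqOn_dense closure_eq_top ?_
  rintro x (rfl | rfl | rfl)
  exacts [hu, ht, hc]

lemma hom_eq_one {A : Type*} [CommGroup A] (F : BraidGroup 4 →* A) (x : BraidCommutator) :
    F x = 1 :=
  Abelianization.commutator_subset_ker F x.2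

end BraidCommutator

/-- The automorphism `x ↦ y⁻¹ x`, `y ↦ x` of the free group on `x = of 0` and `y = of 1`; this is
the action of `σ₁` on `σ₂ σ₁⁻¹` and `σ₁⁻¹ σ₂`. -/
def freeTwist : FreeGroup (Fin 2) ≃* FreeGroup (Fin 2) :=
  MonoidHom.toMulEquiv
    (FreeGroup.lift ![(FreeGroup.of 1)⁻¹ * FreeGroup.of 0, FreeGroup.of 0])
    (FreeGroup.lift ![FreeGroup.of 1, FreeGroup.of 1 * (FreeGroup.of 0)⁻¹])
    (by ext i; fin_cases i <;> simp)
    (by ext i; fin_cases i <;> simp)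

lemma freeTwist_of_zero :
    freeTwist (FreeGroup.of 0) = (FreeGroup.of 1)⁻¹ * FreeGroup.of 0 := by
  simp [freeTwist, MonoidHom.toMulEquiv]

lemma freeTwist_of_one : freeTwist (FreeGroup.of 1) = FreeGroup.of 0 := by
  simp [freeTwist, MonoidHom.toMulEquiv]

lemma freeTwist_symm_of_zero : freeTwist.symm (FreeGroup.of 0) = FreeGroup.of 1 := by
  rw [MulEquiv.symm_apply_eq, freeTwist_of_one]

/-- The semidirect product of the free group of rank two with `ℤ` acting through `freeTwist`; it is
isomorphic to the braid group on three strings. -/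
abbrev FreeTwistProduct : Type :=
  FreeGroup (Fin 2) ⋊[zpowersHom (MulAut (FreeGroup (Fin 2))) freeTwist] Multiplicative ℤ

open SemidirectProduct in
lemma exists_hom_freeTwistProduct : ∃ F : BraidGroup 4 →* FreeTwistProduct,
    F (σ 0) = inr (Multiplicative.ofAdd 1) ∧
    F (σ 1) = inl (FreeGroup.of 0) * inr (Multiplicative.ofAdd 1) ∧
    F (σ 2) = inr (Multiplicative.ofAdd 1) := by
  have h : (inr (Multiplicative.ofAdd 1) : FreeTwistProduct) *
      (inl (FreeGroup.of 0) * inr (Multiplicative.ofAdd 1)) * inr (Multiplicative.ofAdd 1) =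
      (inl (FreeGroup.of 0) * inr (Multiplicative.ofAdd 1)) * inr (Multiplicative.ofAdd 1) *
      (inl (FreeGroup.of 0) * inr (Multiplicative.ofAdd 1)) := by
    ext
    · simp [pow_two, freeTwist_of_zero, freeTwist_of_one]
    · simp
  exact exists_hom_braidGroup_four h h.symm rfl

namespace BraidCommutator

open SemidirectProduct in
lemma exists_hom_of_c_eq_one {H : Type*} [Group H] (p q : H) :
    ∃ F : BraidCommutator →* H, F u = p ∧ F t = q ∧ F c = 1 := by
  obtain ⟨ρ, h0, h1, h2⟩ := exists_hom_freeTwistProduct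
  have hright (x : BraidCommutator) : (ρ x).right = 1 := hom_eq_one (rightHom.comp ρ) x
  let F : BraidCommutator →* FreeGroup (Fin 2) :=
    { toFun x := (ρ x).left
      map_one' := by simp
      map_mul' x y := by simp [hright] }
  refine ⟨(FreeGroup.lift ![p, q]).comp F, ?_, ?_, ?_⟩
  · simp [F, u, h0, h1]
  · simp [F, t, h0, h1, freeTwist_symm_of_zero]
  · simp [F, c, h0, h2]

end BraidCommutator

/-- The wreath product of `A` with the symmetric group of degree four. -/
abbrev PermWreath (A : Type*) [Group A] : Type _ := (Fin 4 → A) ⋊[mulAutArrow] Equiv.Perm (Fin 4)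

namespace PermWreath

variable {A : Type*} [Group A]

lemma mul_left_apply (x y : PermWreath A) (i : Fin 4) :
    (x * y).left i = x.left i * y.left (x.right⁻¹ i) := rfl

lemma inv_left_apply (x : PermWreath A) (i : Fin 4) :
    x⁻¹.left i = (x.left (x.right i))⁻¹ := by
  change (x.left ((x.right⁻¹)⁻¹ i))⁻¹ = _
  rw [inv_inv]

end PermWreath

/-- The values of the determinant on the representatives `(1, 0)`, `(0, 1)`, `(1, 1)`, `(1, -1)` of
the points of the projective line over `ZMod 3`. -/
def lineForm (i j : Fin 4) : ℤ :=
  !![0, 1, 1, -1; -1, 0, -1, -1; -1, 1, 0, 1; 1, 1, -1, 0] i j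

/-- The signed permutations preserving `lineForm`, a group isomorphic to `SL(2, 3)`. -/
def lineFormStabilizer : Subgroup (PermWreath ℤˣ) where
  carrier := {x | ∀ i j, (x.left i * x.left j : ℤ) * lineForm (x.right⁻¹ i) (x.right⁻¹ j) =
    lineForm i j}
  one_mem' i j := by
    rw [SemidirectProduct.one_left, SemidirectProduct.one_right, inv_one]
    simp
  mul_mem' {x y} hx hy i j := by
    rw [← hx i j, ← hy (x.right⁻¹ i) (x.right⁻¹ j)]
    simp only [PermWreath.mul_left_apply, SemidirectProduct.mul_right, mul_inv_rev,
      Equiv.Perm.mul_apply]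
    push_cast
    ring
  inv_mem' {x} hx i j := by
    have h := hx (x.right i) (x.right j)
    rw [Equiv.Perm.inv_eq_iff_eq.mpr rfl, Equiv.Perm.inv_eq_iff_eq.mpr rfl] at h
    rw [PermWreath.inv_left_apply, PermWreath.inv_left_apply, SemidirectProduct.inv_right, inv_inv,
      ← h]
    have e (z : ℤˣ) : ((z⁻¹ : ℤˣ) : ℤ) * z = 1 := by simp
    generalize lineForm i j = k
    linear_combination k * ((x.left (x.right j))⁻¹ * x.left (x.right j) : ℤ) *
      e (x.left (x.right i)) + k * e (x.left (x.right j))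

instance : DecidablePred (· ∈ lineFormStabilizer) := fun x ↦
  inferInstanceAs (Decidable (∀ i j, (x.left i * x.left j : ℤ) *
    lineForm (x.right⁻¹ i) (x.right⁻¹ j) = lineForm i j))

lemma exists_mem_lineFormStabilizer : ∀ g : Equiv.Perm (Fin 4), Equiv.Perm.sign g = 1 →
    ∃ ε : Fin 4 → ℤˣ, (⟨ε, g⟩ : PermWreath ℤˣ) ∈ lineFormStabilizer := by
  decide +kernel

lemma lineFormStabilizer_relations_false :
    ∀ ε : Fin 4 → ℤˣ,
      (⟨ε, Equiv.swap 1 2 * Equiv.swap 0 1⟩ : PermWreath ℤˣ) ∈ lineFormStabilizer →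
    ∀ δ : Fin 4 → ℤˣ,
      (⟨δ, Equiv.swap 2 3 * Equiv.swap 0 1⟩ : PermWreath ℤˣ) ∈ lineFormStabilizer →
    ∀ η : Fin 4 → ℤˣ,
      (⟨η, Equiv.swap 0 1 * Equiv.swap 1 2⟩ : PermWreath ℤˣ) ∈ lineFormStabilizer →
    let U : PermWreath ℤˣ := ⟨ε, Equiv.swap 1 2 * Equiv.swap 0 1⟩
    let C : PermWreath ℤˣ := ⟨δ, Equiv.swap 2 3 * Equiv.swap 0 1⟩
    let T : PermWreath ℤˣ := ⟨η, Equiv.swap 0 1 * Equiv.swap 1 2⟩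
    let W := U * C * U⁻¹
    ¬ ((T * C).left = (C * W * T).left ∧ (T * W).left = (C * W * W * T).left ∧
      (U * W).left = (W * W * C⁻¹ * W * U).left) := by
  decide +kernel

lemma exists_hom_permWreath_int : ∃ F : BraidGroup 4 →* PermWreath (Multiplicative ℤ),
    F (σ 0) = ⟨Multiplicative.ofAdd ∘ ![1, 1, 0, 0], Equiv.swap 0 1⟩ ∧
    F (σ 1) = ⟨Multiplicative.ofAdd ∘ ![0, 1, 1, 0], Equiv.swap 1 2⟩ ∧
    F (σ 2) = ⟨Multiplicative.ofAdd ∘ ![0, 0, 1, 1], Equiv.swap 2 3⟩ := by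
  apply exists_hom_braidGroup_four <;> refine SemidirectProduct.ext ?_ (by decide) <;> funext i <;>
    fin_cases i <;> decide

/-- The homomorphism to `A` multiplying the coordinates. -/
def PermWreath.prodHom (A : Type*) [CommGroup A] : PermWreath A →* A where
  toFun x := ∏ i, x.left i
  map_one' := by simp
  map_mul' x y := by
    simp only [PermWreath.mul_left_apply, Finset.prod_mul_distrib]
    rw [Equiv.prod_comp (x.right⁻¹ : Equiv.Perm (Fin 4)) y.left]

set_option synthInstance.maxHeartbeats 200000 in
set_option synthInstance.maxSize 1000 in
lemma Equiv.Perm.exists_conj_eq_of_relation : ∀ U C : Equiv.Perm (Fin 4), Equiv.Perm.sign U = 1 →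
    Equiv.Perm.sign C = 1 → C ≠ 1 →
    U * (U * C * U⁻¹) = U * C * U⁻¹ * (U * C * U⁻¹) * C⁻¹ * (U * C * U⁻¹) * U →
    ∃ τ : Equiv.Perm (Fin 4), τ * U * τ⁻¹ = Equiv.swap 1 2 * Equiv.swap 0 1 ∧
      τ * C * τ⁻¹ = Equiv.swap 2 3 * Equiv.swap 0 1 := by
  decide +kernel

lemma Equiv.Perm.eq_of_relations : ∀ T : Equiv.Perm (Fin 4),
    T * (Equiv.swap 2 3 * Equiv.swap 0 1) =
      Equiv.swap 2 3 * Equiv.swap 0 1 * (Equiv.swap 0 2 * Equiv.swap 1 3) * T →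
    T * (Equiv.swap 0 2 * Equiv.swap 1 3) =
      Equiv.swap 2 3 * Equiv.swap 0 1 * (Equiv.swap 0 2 * Equiv.swap 1 3) *
        (Equiv.swap 0 2 * Equiv.swap 1 3) * T →
    T = Equiv.swap 0 1 * Equiv.swap 1 2 ∨ T = Equiv.swap 1 3 * Equiv.swap 3 2 ∨
      T = Equiv.swap 0 2 * Equiv.swap 2 3 ∨ T = Equiv.swap 0 3 * Equiv.swap 3 1 := by
  decide +kernel

section Coboundary

open Multiplicative SemidirectProduct

lemma PermWreath.exists_conj_inr {U T C W : PermWreath (Multiplicative ℤ)}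
    (hU : U.right = Equiv.swap 1 2 * Equiv.swap 0 1)
    (hC : C.right = Equiv.swap 2 3 * Equiv.swap 0 1)
    (hW : W.right = Equiv.swap 0 2 * Equiv.swap 1 3)
    (hT : T.right = Equiv.swap 1 3 * Equiv.swap 3 2 ∨ T.right = Equiv.swap 0 2 * Equiv.swap 2 3 ∨
      T.right = Equiv.swap 0 3 * Equiv.swap 3 1)
    (huc : U * C = W * U) (huw : U * W = W * W * C⁻¹ * W * U) (htc : T * C = C * W * T)
    (htw : T * W = C * W * W * T) (pU : PermWreath.prodHom _ U = 1)
    (pT : PermWreath.prodHom _ T = 1) (pC : PermWreath.prodHom _ C = 1) :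
    ∃ m : PermWreath (Multiplicative ℤ), ∀ X ∈ ({U, T, C} : Set (PermWreath (Multiplicative ℤ))),
      X = m * inr X.right * m⁻¹ := by
  have hU' : U.right⁻¹ 0 = 1 ∧ U.right⁻¹ 1 = 2 ∧ U.right⁻¹ 2 = 0 ∧ U.right⁻¹ 3 = 3 := by
    rw [hU]; decide
  have hC' : C.right⁻¹ 0 = 1 ∧ C.right⁻¹ 1 = 0 ∧ C.right⁻¹ 2 = 3 ∧ C.right⁻¹ 3 = 2 := by
    rw [hC]; decide
  have hC'' : C.right 0 = 1 ∧ C.right 1 = 0 ∧ C.right 2 = 3 ∧ C.right 3 = 2 := by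
    rw [hC]; decide
  have hW' : W.right⁻¹ 0 = 2 ∧ W.right⁻¹ 1 = 3 ∧ W.right⁻¹ 2 = 0 ∧ W.right⁻¹ 3 = 1 := by
    rw [hW]; decide
  obtain ⟨u0, u1, u2, u3⟩ := hU'
  obtain ⟨c0, c1, c2, c3⟩ := hC'
  obtain ⟨c0', c1', c2', c3'⟩ := hC''
  obtain ⟨w0, w1, w2, w3⟩ := hW'
  have toEq {X Y : PermWreath (Multiplicative ℤ)} (h : X = Y) (i : Fin 4) :
    toAdd (X.left i) = toAdd (Y.left i) := by rw [h]
  have a0 := toEq huc 0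
  have a1 := toEq huc 1
  have a2 := toEq huc 2
  have a3 := toEq huc 3
  have b0 := toEq huw 0
  have b1 := toEq huw 1
  have b2 := toEq huw 2
  have b3 := toEq huw 3
  have e0 := toEq htc 0
  have e1 := toEq htc 1
  have e2 := toEq htc 2
  have e3 := toEq htc 3
  have f0 := toEq htw 0
  have f1 := toEq htw 1
  have f2 := toEq htw 2
  have f3 := toEq htw 3
  have pU' := congrArg toAdd pU
  have pT' := congrArg toAdd pT
  have pC' := congrArg toAdd pC
  simp only [PermWreath.prodHom, MonoidHom.coe_mk, OneHom.coe_mk, Fin.prod_univ_four, toAdd_mul,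
    toAdd_one] at pU' pT' pC'
  have hT' : (T.right⁻¹ 0 = 0 ∧ T.right⁻¹ 1 = 2 ∧ T.right⁻¹ 2 = 3 ∧ T.right⁻¹ 3 = 1) ∨
      (T.right⁻¹ 0 = 3 ∧ T.right⁻¹ 1 = 1 ∧ T.right⁻¹ 2 = 0 ∧ T.right⁻¹ 3 = 2) ∨
      (T.right⁻¹ 0 = 1 ∧ T.right⁻¹ 1 = 3 ∧ T.right⁻¹ 2 = 2 ∧ T.right⁻¹ 3 = 0) := by
    rcases hT with hT | hT | hT <;> rw [hT] <;> decide
  obtain ⟨M, M0, M1, M2, M3⟩ : ∃ M : Fin 4 → ℤ, M 0 = toAdd (C.left 2) + toAdd (W.left 0) ∧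
      M 1 = toAdd (W.left 1) ∧ M 2 = toAdd (C.left 2) ∧ M 3 = 0 :=
    ⟨![_, _, _, _], rfl, rfl, rfl, rfl⟩
  have key : (∀ i, toAdd (U.left i) = M i - M (U.right⁻¹ i)) ∧
      (∀ i, toAdd (T.left i) = M i - M (T.right⁻¹ i)) ∧
      (∀ i, toAdd (C.left i) = M i - M (C.right⁻¹ i)) := by
    rcases hT' with ⟨t0, t1, t2, t3⟩ | ⟨t0, t1, t2, t3⟩ | ⟨t0, t1, t2, t3⟩ <;>
    · simp only [PermWreath.mul_left_apply, PermWreath.inv_left_apply, mul_right, inv_right,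
        inv_inv, mul_inv_rev, Equiv.Perm.mul_apply, toAdd_mul, toAdd_inv, u0, u1, u2, u3, c0, c1,
        c2, c3, c0', c1', c2', c3', w0, w1, w2, w3, t0, t1, t2, t3]
        at a0 a1 a2 a3 b0 b1 b2 b3 e0 e1 e2 e3 f0 f1 f2 f3
      simp only [Fin.forall_fin_succ, Fin.isValue, Fin.succ_zero_eq_one, Fin.succ_one_eq_two,
        IsEmpty.forall_iff, and_true, u0, u1, u2, u3, c0, c1, c2, c3, t0, t1, t2, t3,
        show Fin.succ (2 : Fin 3) = 3 from rfl, M0, M1, M2, M3]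
      refine ⟨⟨?_, ?_, ?_, ?_⟩, ⟨?_, ?_, ?_, ?_⟩, ?_, ?_, ?_, ?_⟩ <;>
        linarith only [a0, a1, a2, a3, b0, b1, b2, b3, e0, e1, e2, e3, f0, f1, f2, f3,
          pU', pT', pC']
  have conj {X : PermWreath (Multiplicative ℤ)}
      (h : ∀ i, toAdd (X.left i) = M i - M (X.right⁻¹ i)) :
      X = inl (ofAdd ∘ M) * inr X.right * (inl (ofAdd ∘ M))⁻¹ := by
    refine SemidirectProduct.ext (funext fun i ↦ toAdd.injective ?_) (by simp)
    simp [h, PermWreath.mul_left_apply, PermWreath.inv_left_apply, sub_eq_add_neg]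
  refine ⟨inl (ofAdd ∘ M), ?_⟩
  rintro X (rfl | rfl | rfl)
  exacts [conj key.1, conj key.2.1, conj key.2.2]

end Coboundary

namespace BraidCommutator

lemma map_automorphism_c_ne_one {f : BraidCommutator →* Equiv.Perm (Fin 4)}
    (hs : ∀ x, Equiv.Perm.sign (f x) = 1) (hu : f u = Equiv.swap 1 2 * Equiv.swap 0 1)
    (ht : f t = Equiv.swap 0 1 * Equiv.swap 1 2) (hc : f c = Equiv.swap 2 3 * Equiv.swap 0 1)
    (φ : MulAut BraidCommutator) : f (φ c) ≠ 1 := by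
  intro h
  obtain ⟨ε, hε⟩ := exists_mem_lineFormStabilizer (f (φ u)) (hs _)
  obtain ⟨δ, hδ⟩ := exists_mem_lineFormStabilizer (f (φ t)) (hs _)
  obtain ⟨L, Lu, Lt, Lc⟩ := exists_hom_of_c_eq_one (⟨ε, f (φ u)⟩ : PermWreath ℤˣ) ⟨δ, f (φ t)⟩
  have hmem (x : BraidCommutator) : L x ∈ lineFormStabilizer := by
    have : Subgroup.closure {u, t, c} ≤ lineFormStabilizer.comap L := by
      rw [Subgroup.closure_le]
      rintro y (rfl | rfl | rfl)
      · simpa [Lu] using hε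
      · simpa [Lt] using hδ
      · simp [Lc]
    exact this (closure_eq_top ▸ Subgroup.mem_top x)
  have hright : SemidirectProduct.rightHom.comp L = f.comp φ.toMonoidHom :=
    hom_ext (by simp [Lu]) (by simp [Lt]) (by simp [Lc, h])
  let L' : BraidCommutator →* PermWreath ℤˣ := L.comp φ⁻¹.toMonoidHom
  have hL' (x : BraidCommutator) : L' x = ⟨(L' x).left, f x⟩ := by
    refine SemidirectProduct.ext rfl ?_
    simpa [L'] using DFunLike.congr_fun hright (φ⁻¹ x)
  have hmem' (x : BraidCommutator) : (⟨(L' x).left, f x⟩ : PermWreath ℤˣ) ∈ lineFormStabilizer :=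
    hL' x ▸ hmem _
  have key := lineFormStabilizer_relations_false _ (hu ▸ hmem' u) _ (hc ▸ hmem' c) _
    (ht ▸ hmem' t)
  rw [← hu, ← hc, ← ht, ← hL', ← hL', ← hL'] at key
  refine key ⟨?_, ?_, ?_⟩ <;> simp only [← map_mul, ← map_inv]
  · exact congrArg _ (congrArg L' t_mul_c)
  · exact congrArg _ (congrArg L' t_mul_w)
  · exact congrArg _ (congrArg L' u_mul_w)

open SemidirectProduct in
lemma exists_conj_comp_automorphism (μ : BraidGroup 4 →* Equiv.Perm (Fin 4))
    (h0 : μ (σ 0) = Equiv.swap 0 1) (h1 : μ (σ 1) = Equiv.swap 1 2)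
    (h2 : μ (σ 2) = Equiv.swap 2 3) (φ : MulAut BraidCommutator) :
    ∃ τ : Equiv.Perm (Fin 4), ∀ x : BraidCommutator, τ * μ (φ x) * τ⁻¹ = μ x := by
  let f : BraidCommutator →* Equiv.Perm (Fin 4) := μ.comp (commutator (BraidGroup 4)).subtype
  have hs (x : BraidCommutator) : Equiv.Perm.sign (f x) = 1 :=
    hom_eq_one ((Equiv.Perm.sign : Equiv.Perm (Fin 4) →* ℤˣ).comp μ) x
  have hu : f u = Equiv.swap 1 2 * Equiv.swap 0 1 := by simp [f, u, h0, h1]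
  have ht : f t = Equiv.swap 0 1 * Equiv.swap 1 2 := by simp [f, t, h0, h1]
  have hc : f c = Equiv.swap 2 3 * Equiv.swap 0 1 := by simp [f, c, h0, h2]
  have hrel {H : Type} [Group H] (g : BraidCommutator →* H) :
      g u * g w = g w * g w * (g c)⁻¹ * g w * g u := by
    simpa only [map_mul, map_inv] using congrArg g u_mul_w
  obtain ⟨τ, τu, τc⟩ := Equiv.Perm.exists_conj_eq_of_relation (f (φ u)) (f (φ c)) (hs _) (hs _)
    (map_automorphism_c_ne_one hs hu ht hc φ) (by simpa [w] using hrel (f.comp φ.toMonoidHom))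
  let g : BraidCommutator →* Equiv.Perm (Fin 4) :=
    (MulAut.conj τ).toMonoidHom.comp (f.comp φ.toMonoidHom)
  have gu : g u = Equiv.swap 1 2 * Equiv.swap 0 1 := τu
  have gc : g c = Equiv.swap 2 3 * Equiv.swap 0 1 := τc
  have gw : g w = Equiv.swap 0 2 * Equiv.swap 1 3 := by
    rw [w, map_mul, map_mul, map_inv, gu, gc]; decide
  refine ⟨τ, DFunLike.congr_fun (f := g) (g := f) ?_⟩
  rcases Equiv.Perm.eq_of_relations (g t)
    (by rw [← gw, ← gc, ← map_mul, ← map_mul, ← map_mul, t_mul_c])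
    (by rw [← gw, ← gc, ← map_mul, ← map_mul, ← map_mul, ← map_mul, t_mul_w]) with gt | gt
  · exact hom_ext (gu.trans hu.symm) (gt.trans ht.symm) (gc.trans hc.symm)
  · exfalso
    obtain ⟨F, F0, F1, F2⟩ := exists_hom_permWreath_int
    have hF : rightHom.comp F = μ := by
      refine MonoidHom.ext fun x ↦ mem_of_σ_mem (N := (rightHom.comp F).eqLocus μ) ?_ ?_ ?_ x
      · change rightHom (F (σ 0)) = _; simp [F0, h0]
      · change rightHom (F (σ 1)) = _; simp [F1, h1]
      · change rightHom (F (σ 2)) = _; simp [F2, h2]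
    let K : BraidGroup 4 →* PermWreath (Multiplicative ℤ) :=
      (MulAut.conj (inr τ)).toMonoidHom.comp F
    let G : BraidCommutator →* PermWreath (Multiplicative ℤ) :=
      K.comp ((commutator (BraidGroup 4)).subtype.comp φ.toMonoidHom)
    have hG : rightHom.comp G = g := by
      ext1 x
      have h := DFunLike.congr_fun hF (φ x : BraidGroup 4)
      simp only [MonoidHom.comp_apply, rightHom_eq_right] at h
      simp [G, K, g, f, h]
    have hGr (x : BraidCommutator) : (G x).right = g x := DFunLike.congr_fun hG x
    have hGp (x : BraidCommutator) : PermWreath.prodHom _ (G x) = 1 :=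
      hom_eq_one ((PermWreath.prodHom _).comp K) (φ x)
    obtain ⟨m, hm⟩ := PermWreath.exists_conj_inr ((hGr u).trans gu) ((hGr c).trans gc) ((hGr w).trans gw)
      (hGr t ▸ gt) (by rw [← map_mul, ← map_mul, u_mul_c]) (hrel G)
      (by rw [← map_mul, ← map_mul, ← map_mul, t_mul_c])
      (by rw [← map_mul, ← map_mul, ← map_mul, ← map_mul, t_mul_w]) (hGp u) (hGp t) (hGp c)
    have hGm : G = (MulAut.conj m).toMonoidHom.comp (inr.comp g) := by
      refine hom_ext ?_ ?_ ?_
      · simpa [hGr] using hm (G u) (by simp)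
      · simpa [hGr] using hm (G t) (by simp)
      · simpa [hGr] using hm (G c) (by simp)
    have hftu : f (t * u) = 1 := by rw [map_mul, ht, hu]; decide
    have hgy : g (φ⁻¹ (t * u)) = 1 := by
      simp only [g, MonoidHom.comp_apply, MulEquiv.toMonoidHom_eq_coe, MonoidHom.coe_coe,
        MulAut.apply_inv_self, hftu, map_one]
    have hGy : G (φ⁻¹ (t * u)) = 1 := by
      rw [hGm]
      simp only [MonoidHom.comp_apply, hgy, map_one]
    have hFtu : F (t * u : BraidCommutator) = 1 := by
      simpa [G, K] using hGy
    have hF' : F (t * u : BraidCommutator) =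
        (F (σ 0))⁻¹ * F (σ 1) * (F (σ 1) * (F (σ 0))⁻¹) := by simp [t, u]
    rw [hF', F0, F1] at hFtu
    exact absurd (congrArg SemidirectProduct.left hFtu) (by decide)

end BraidCommutator

/-- `J_4 = B'_4 ∩ P_4` is a characteristic subgroup of `B'_4`: for every automorphism
`φ` of `B'_4` and every `x ∈ B'_4` lying in `J_4` (i.e. in the kernel of
`μ : B_4 → S_4`), `φ x` also lies in `J_4`. -/
theorem J4_characteristic (μ : BraidGroup 4 →* Equiv.Perm (Fin 4))
    (hμ : ∀ i : Fin (4 - 1), μ (σ i) =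
      Equiv.swap ⟨(i : ℕ), by have := i.isLt; omega⟩ ⟨(i : ℕ) + 1, by have := i.isLt; omega⟩)
    (φ : MulAut ↥(commutator (BraidGroup 4)))
    (x : ↥(commutator (BraidGroup 4)))
    (hx : (x : BraidGroup 4) ∈ μ.ker) :
    ((φ x : ↥(commutator (BraidGroup 4))) : BraidGroup 4) ∈ μ.ker := by
  obtain ⟨τ, hτ⟩ := BraidCommutator.exists_conj_comp_automorphism μ (hμ 0) (hμ 1) (hμ 2) φ
  have h := hτ x
  rw [MonoidHom.mem_ker.mp hx] at h
  rwa [MonoidHom.mem_ker, ← conj_eq_one_iff (a := τ)]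
end

section
/- J_3 is not a characteristic subgroup of B'_3: there exists an automorphism φ of B'_3 such that the image of J_3 under φ is not equal to J_3. -/
/-- The Artin generators `σ₁` and `σ₂` of `B_3` satisfy the braid relation. -/
theorem braid_relation_three :
    σ (n := 3) 0 * σ (n := 3) 1 * σ (n := 3) 0 =
      σ (n := 3) 1 * σ (n := 3) 0 * σ (n := 3) 1 := by
  have h : PresentedGroup.mk (braidRels 3) _ = 1 :=
    PresentedGroup.one_of_mem (rels := braidRels 3) (Or.inr ⟨0, 1, rfl, rfl⟩)
  rw [map_mul, map_inv, mul_inv_eq_one] at h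
  exact h

/-- Elements of a group satisfying the braid relation define a homomorphism from `B_3`. -/
def braidThreeLift {G : Type*} [Group G] (a b : G) (h : a * b * a = b * a * b) :
    BraidGroup 3 →* G :=
  PresentedGroup.toGroup (f := ![a, b]) (by
    rintro r (⟨i, j, hij, rfl⟩ | ⟨i, j, hij, rfl⟩)
    · omega
    · obtain ⟨rfl, rfl⟩ : i = 0 ∧ j = 1 := by
        revert i j
        decide
      rw [map_mul, map_inv, mul_inv_eq_one]
      simpa using h)

theorem braidThreeLift_σ_zero {G : Type*} [Group G] (a b : G) (h : a * b * a = b * a * b) :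
    braidThreeLift a b h (σ 0) = a :=
  PresentedGroup.toGroup.of _

theorem braidThreeLift_σ_one {G : Type*} [Group G] (a b : G) (h : a * b * a = b * a * b) :
    braidThreeLift a b h (σ 1) = b :=
  PresentedGroup.toGroup.of _

/-- The automorphism `u ↦ t`, `t ↦ u⁻¹ t` of the free group on `u` and `t`. -/
def braidThreeAction : MulAut (FreeGroup (Fin 2)) :=
  MonoidHom.toMulEquiv
    (FreeGroup.lift ![FreeGroup.of 1, (FreeGroup.of 0)⁻¹ * FreeGroup.of 1])
    (FreeGroup.lift ![FreeGroup.of 0 * (FreeGroup.of 1)⁻¹, FreeGroup.of 0])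
    (by ext i; fin_cases i <;> simp)
    (by ext i; fin_cases i <;> simp)

theorem braidThreeAction_of_zero : braidThreeAction (FreeGroup.of 0) = FreeGroup.of 1 := by
  simp [braidThreeAction]

theorem braidThreeAction_of_one :
    braidThreeAction (FreeGroup.of 1) = (FreeGroup.of 0)⁻¹ * FreeGroup.of 1 := by
  simp [braidThreeAction]

/-- The semidirect product of the free group of rank two with `ℤ` to which `B_3` is isomorphic. -/
abbrev BraidThreeModel :=
  FreeGroup (Fin 2) ⋊[zpowersHom _ braidThreeAction] Multiplicative ℤ

/-- The homomorphism from `B_3` to its semidirect product model. -/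
def braidThreeToModel : BraidGroup 3 →* BraidThreeModel :=
  braidThreeLift (SemidirectProduct.inr (Multiplicative.ofAdd 1))
    (SemidirectProduct.inl (FreeGroup.of 0) * SemidirectProduct.inr (Multiplicative.ofAdd 1)) (by
      ext <;>
        simp [pow_two, braidThreeAction_of_zero, braidThreeAction_of_one, zpowersHom_apply])

/-- The homomorphism `u ↦ σ₂ σ₁⁻¹`, `t ↦ σ₁ σ₂ σ₁⁻²` from the free group of rank two to `B_3`. -/
def freeToBraidThree : FreeGroup (Fin 2) →* BraidGroup 3 :=
  FreeGroup.lift ![σ 1 * (σ 0)⁻¹, σ 0 * (σ 1 * (σ 0)⁻¹) * (σ 0)⁻¹]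

theorem freeToBraidThree_of_zero :
    freeToBraidThree (FreeGroup.of 0) = σ 1 * (σ 0)⁻¹ := by
  simp [freeToBraidThree]

theorem freeToBraidThree_of_one :
    freeToBraidThree (FreeGroup.of 1) = σ 0 * (σ 1 * (σ 0)⁻¹) * (σ 0)⁻¹ := by
  simp [freeToBraidThree]

theorem freeToBraidThree_braidThreeAction (x : FreeGroup (Fin 2)) :
    freeToBraidThree (braidThreeAction x) = σ 0 * freeToBraidThree x * (σ 0)⁻¹ := by
  suffices h : freeToBraidThree.comp braidThreeAction.toMonoidHom =
      (MulAut.conj (σ 0)).toMonoidHom.comp freeToBraidThree from DFunLike.congr_fun h x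
  ext i
  fin_cases i
  · simp [braidThreeAction_of_zero, freeToBraidThree_of_zero, freeToBraidThree_of_one]
  · simp only [Fin.mk_one, MonoidHom.comp_apply, MulEquiv.toMonoidHom_eq_coe, MonoidHom.coe_coe,
      braidThreeAction_of_one, map_mul, map_inv, freeToBraidThree_of_zero,
      freeToBraidThree_of_one, MulAut.conj_apply]
    rw [inv_mul_eq_iff_eq_mul]
    simp only [mul_assoc, inv_mul_cancel_left]
    have h' := braid_relation_three
    simp only [← mul_assoc] at h' ⊢
    rw [← h']
    group

/-- The homomorphism from the semidirect product model to `B_3`. -/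
def modelToBraidThree : BraidThreeModel →* BraidGroup 3 :=
  SemidirectProduct.lift freeToBraidThree (zpowersHom _ (σ 0)) (by
    intro n
    have h : ∀ (k : ℤ) (x : FreeGroup (Fin 2)),
        freeToBraidThree ((braidThreeAction ^ k) x) =
          σ 0 ^ k * freeToBraidThree x * (σ 0 ^ k)⁻¹ := by
      intro k
      induction k with
      | zero => simp
      | succ k ih =>
        intro x
        rw [zpow_add_one, MulAut.mul_apply, ih, freeToBraidThree_braidThreeAction]
        group
      | pred k ih =>
        intro x
        have hx := freeToBraidThree_braidThreeAction (braidThreeAction⁻¹ x)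
        rw [MulAut.apply_inv_self] at hx
        rw [zpow_sub_one, MulAut.mul_apply, ih, zpow_sub_one, hx]
        group
    ext i
    exact h n.toAdd _)

theorem modelToBraidThree_braidThreeToModel (w : BraidGroup 3) :
    modelToBraidThree (braidThreeToModel w) = w := by
  suffices h : modelToBraidThree.comp braidThreeToModel = MonoidHom.id _ from
    DFunLike.congr_fun h w
  refine PresentedGroup.ext fun i => ?_
  change modelToBraidThree (braidThreeToModel (σ i)) = σ i
  fin_cases i
  · change modelToBraidThree (braidThreeToModel (σ 0)) = σ 0
    simp [modelToBraidThree, braidThreeToModel, braidThreeLift_σ_zero]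
  · change modelToBraidThree (braidThreeToModel (σ 1)) = σ 1
    simp [modelToBraidThree, braidThreeToModel, braidThreeLift_σ_one, freeToBraidThree_of_zero]

theorem braidThreeToModel_freeToBraidThree (x : FreeGroup (Fin 2)) :
    braidThreeToModel (freeToBraidThree x) = SemidirectProduct.inl x := by
  suffices h : braidThreeToModel.comp freeToBraidThree = SemidirectProduct.inl from
    DFunLike.congr_fun h x
  ext i
  all_goals
    fin_cases i <;>
      simp [freeToBraidThree_of_zero, freeToBraidThree_of_one, braidThreeToModel,
        braidThreeLift_σ_zero, braidThreeLift_σ_one, braidThreeAction_of_zero, zpowersHom_apply]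

theorem freeToBraidThree_injective : Function.Injective freeToBraidThree := fun x y h =>
  SemidirectProduct.inl_injective (by
    rw [← braidThreeToModel_freeToBraidThree x, h, braidThreeToModel_freeToBraidThree])

open scoped commutatorElement in
theorem freeToBraidThree_range : freeToBraidThree.range = commutator (BraidGroup 3) := by
  apply le_antisymm
  · have hu : σ (n := 3) 1 * (σ 0)⁻¹ ∈ commutator (BraidGroup 3) := by
      have h : σ (n := 3) 1 * (σ 0)⁻¹ = ⁅σ (n := 3) 0 * σ 1, σ (n := 3) 0⁆ := by
        rw [commutatorElement_def, braid_relation_three]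
        group
      rw [h]
      exact Subgroup.commutator_mem_commutator (Subgroup.mem_top _) (Subgroup.mem_top _)
    refine FreeGroup.range_lift_le ?_
    rintro _ ⟨i, rfl⟩
    fin_cases i
    · exact hu
    · exact (inferInstance : (commutator (BraidGroup 3)).Normal).conj_mem _ hu _
  · intro w hw
    have h := Abelianization.commutator_subset_ker
      (SemidirectProduct.rightHom.comp braidThreeToModel) hw
    rw [MonoidHom.mem_ker, MonoidHom.comp_apply, ← MonoidHom.mem_ker,
      ← SemidirectProduct.range_inl_eq_ker_rightHom] at h
    obtain ⟨x, hx⟩ := h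
    refine ⟨x, ?_⟩
    rw [← modelToBraidThree_braidThreeToModel w, ← hx, modelToBraidThree,
      SemidirectProduct.lift_inl]

/-- The commutator subgroup of `B_3` is free of rank two. -/
noncomputable def freeEquivCommutatorBraidThree :
    FreeGroup (Fin 2) ≃* commutator (BraidGroup 3) :=
  (MonoidHom.ofInjective freeToBraidThree_injective).trans
    (MulEquiv.subgroupCongr freeToBraidThree_range)

theorem coe_freeEquivCommutatorBraidThree (x : FreeGroup (Fin 2)) :
    (freeEquivCommutatorBraidThree x : BraidGroup 3) = freeToBraidThree x :=
  rfl

/-- The automorphism `u ↦ u`, `t ↦ t u` of the free group on `u` and `t`. -/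
def freeTransvection : MulAut (FreeGroup (Fin 2)) :=
  MonoidHom.toMulEquiv
    (FreeGroup.lift ![FreeGroup.of 0, FreeGroup.of 1 * FreeGroup.of 0])
    (FreeGroup.lift ![FreeGroup.of 0, FreeGroup.of 1 * (FreeGroup.of 0)⁻¹])
    (by ext i; fin_cases i <;> simp)
    (by ext i; fin_cases i <;> simp)

/-- `J_3 = B'_3 ∩ P_3` is not a characteristic subgroup of `B'_3`: there is an
automorphism `φ` of `B'_3` such that the image of `J_3` under `φ` differs from
`J_3` (here `J_3` is viewed as the subgroup of `B'_3` of elements lying in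
the kernel of `μ : B_3 → S_3`). -/
theorem J3_not_characteristic (μ : BraidGroup 3 →* Equiv.Perm (Fin 3))
    (hμ : ∀ i : Fin (3 - 1), μ (σ i) =
      Equiv.swap ⟨(i : ℕ), by have := i.isLt; omega⟩ ⟨(i : ℕ) + 1, by have := i.isLt; omega⟩) :
    ∃ φ : MulAut ↥(commutator (BraidGroup 3)),
      Subgroup.map φ.toMonoidHom
          (Subgroup.comap (commutator (BraidGroup 3)).subtype μ.ker) ≠
        Subgroup.comap (commutator (BraidGroup 3)).subtype μ.ker := by
  have h0 : μ (σ 0) = Equiv.swap 0 1 := hμ 0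
  have h1 : μ (σ 1) = Equiv.swap 1 2 := hμ 1
  refine ⟨(freeEquivCommutatorBraidThree.symm.trans freeTransvection).trans
    freeEquivCommutatorBraidThree, fun h => ?_⟩
  have hmem : freeEquivCommutatorBraidThree (FreeGroup.of 0 * FreeGroup.of 1) ∈
      Subgroup.comap (commutator (BraidGroup 3)).subtype μ.ker := by
    rw [Subgroup.mem_comap, MonoidHom.mem_ker, Subgroup.subtype_apply,
      coe_freeEquivCommutatorBraidThree]
    simp only [map_mul, map_inv, freeToBraidThree_of_zero, freeToBraidThree_of_one, h0, h1]
    decide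
  have himage := h ▸ Subgroup.mem_map_of_mem
    ((freeEquivCommutatorBraidThree.symm.trans freeTransvection).trans
      freeEquivCommutatorBraidThree).toMonoidHom hmem
  have hψ : freeTransvection (FreeGroup.of 0 * FreeGroup.of 1) =
      FreeGroup.of 0 * (FreeGroup.of 1 * FreeGroup.of 0) := by
    simp [freeTransvection]
  rw [MulEquiv.toMonoidHom_eq_coe, MonoidHom.coe_coe, MulEquiv.trans_apply, MulEquiv.trans_apply,
    MulEquiv.symm_apply_apply, hψ, Subgroup.mem_comap, MonoidHom.mem_ker, Subgroup.subtype_apply,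
    coe_freeEquivCommutatorBraidThree] at himage
  simp only [map_mul, map_inv, freeToBraidThree_of_zero, freeToBraidThree_of_one, h0, h1]
    at himage
  revert himage
  decide
end

section
/- For every n ≥ 5, the commutator subgroup of the braid group B_n is perfect: B''_n = B'_n, i.e., the commutator subgroup of B'_n equals B'_n itself. -/
/-- Images of braid generators coincide in the abelianization. -/
theorem abelianization_of_eq_of_braid {H : Type*} [Group H] {m : ℕ} (a : Fin m → H)
    (hbraid : ∀ i j : Fin m, (j : ℕ) = i + 1 → a i * a j * a i = a j * a i * a j)
    (i j : Fin m) : Abelianization.of (a i) = Abelianization.of (a j) := by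
  have zero : ∀ (k : ℕ) (hk : k < m),
      Abelianization.of (a ⟨k, hk⟩) = Abelianization.of (a ⟨0, by omega⟩) := by
    intro k
    induction k with
    | zero => intro hk; rfl
    | succ k ih =>
      intro hk
      rw [← ih (by omega)]
      have h := congrArg Abelianization.of (hbraid ⟨k, by omega⟩ ⟨k + 1, hk⟩ rfl)
      simp only [map_mul] at h
      rw [mul_comm (Abelianization.of (a ⟨k + 1, hk⟩)) (Abelianization.of (a ⟨k, by omega⟩))] at h
      exact (mul_left_cancel h).symm
  exact (zero i i.2).trans (zero j j.2).symm

/-- A metabelian group generated by at least four elements satisfying the braid relations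
is commutative. -/
theorem commutator_eq_bot_of_braid {H : Type*} [Group H] {m : ℕ} (hm : 4 ≤ m) (a : Fin m → H)
    (hgen : Subgroup.closure (Set.range a) = ⊤)
    (hfar : ∀ i j : Fin m, (i : ℕ) + 2 ≤ j → Commute (a i) (a j))
    (hbraid : ∀ i j : Fin m, (j : ℕ) = i + 1 → a i * a j * a i = a j * a i * a j)
    (hmet : ∀ x ∈ commutator H, ∀ y ∈ commutator H, Commute x y) :
    commutator H = ⊥ := by
  have hdiv (i j : Fin m) : a i * (a j)⁻¹ ∈ commutator H := by
    rw [← Abelianization.ker_of, MonoidHom.mem_ker, map_mul, map_inv,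
      abelianization_of_eq_of_braid a hbraid i j, mul_inv_cancel]
  have hcenter (x : H) (hx : ∀ i, Commute x (a i)) : x ∈ Subgroup.center H := by
    have hle : Subgroup.closure (Set.range a) ≤ Subgroup.centralizer {x} := by
      rw [Subgroup.closure_le]
      rintro _ ⟨i, rfl⟩
      exact Subgroup.mem_centralizer_singleton_iff.2 (hx i).symm.eq
    rw [hgen] at hle
    exact Subgroup.mem_center_iff.2 fun g =>
      Subgroup.mem_centralizer_singleton_iff.1 (hle (Subgroup.mem_top g))
  have hfar_center (i j : Fin m) (hij : (i : ℕ) + 2 ≤ j) :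
      a j * (a i)⁻¹ ∈ Subgroup.center H := by
    refine hcenter _ fun k => ?_
    have h₁ : Commute (a j * (a i)⁻¹) (a i) :=
      (hfar i j hij).symm.mul_left (Commute.refl (a i)).inv_left
    have h₂ := (hmet _ (hdiv j i) _ (hdiv k i)).mul_right h₁
    rwa [inv_mul_cancel_right] at h₂
  have hzero (i : Fin m) : a i * (a ⟨0, by omega⟩)⁻¹ ∈ Subgroup.center H := by
    rcases Nat.lt_or_ge (i : ℕ) 2 with hi | hi
    · rcases Nat.lt_or_ge (i : ℕ) 1 with hi' | hi'
      · have : i = ⟨0, by omega⟩ := Fin.ext (by simp; omega)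
        rw [← this, mul_inv_cancel]
        exact one_mem _
      · have h₁ := hfar_center i ⟨3, by omega⟩ (by simp; omega)
        have h₂ := hfar_center ⟨0, by omega⟩ ⟨3, by omega⟩ (by simp)
        simpa [mul_assoc] using mul_mem (inv_mem h₁) h₂
    · exact hfar_center _ i (by simpa using hi)
  have hcomm (i j : Fin m) : Commute (a i) (a j) := by
    have hz (k : Fin m) (g : H) : Commute (a k * (a ⟨0, by omega⟩)⁻¹) g :=
      (Subgroup.mem_center_iff.1 (hzero k) g).symm
    have h₀ (k : Fin m) : Commute (a k) (a ⟨0, by omega⟩) := by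
      have h := (hz k (a ⟨0, by omega⟩)).mul_left (Commute.refl _)
      rwa [inv_mul_cancel_right] at h
    have h := (hz i (a j)).mul_left (h₀ j).symm
    rwa [inv_mul_cancel_right] at h
  have htop : Subgroup.center H = ⊤ := by
    rw [eq_top_iff, ← hgen, Subgroup.closure_le]
    rintro _ ⟨i, rfl⟩
    exact hcenter _ (hcomm i)
  rw [commutator_def, Subgroup.commutator_eq_bot_iff_le_centralizer, Subgroup.coe_top,
    Subgroup.centralizer_univ, htop]

theorem σ_commute {n : ℕ} (i j : Fin (n - 1)) (hij : (i : ℕ) + 2 ≤ j) :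
    Commute (σ i : BraidGroup n) (σ j) := by
  have h := PresentedGroup.one_of_mem (rels := braidRels n) (Or.inl ⟨i, j, hij, rfl⟩)
  simp only [map_mul, map_inv] at h
  exact mul_inv_eq_iff_eq_mul.1 (mul_inv_eq_one.1 h)

theorem σ_braid {n : ℕ} (i j : Fin (n - 1)) (hij : (j : ℕ) = i + 1) :
    (σ i * σ j * σ i : BraidGroup n) = σ j * σ i * σ j := by
  have h := PresentedGroup.one_of_mem (rels := braidRels n) (Or.inr ⟨i, j, hij, rfl⟩)
  simp only [map_mul, map_inv] at h
  exact mul_inv_eq_one.1 h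

/-- For `n ≥ 5`, the commutator subgroup `B'_n` of the braid group is perfect:
the commutator subgroup of `B'_n` is all of `B'_n`. -/
theorem commutator_braid_perfect (n : ℕ) (hn : 5 ≤ n) :
    commutator ↥(commutator (BraidGroup n)) = ⊤ := by
  let K : Subgroup (BraidGroup n) := ⁅commutator (BraidGroup n), commutator (BraidGroup n)⁆
  let π := QuotientGroup.mk' K
  have hπ : Function.Surjective π := QuotientGroup.mk'_surjective K
  have hmap : (commutator (BraidGroup n)).map π = commutator (BraidGroup n ⧸ K) := by
    refine (Subgroup.map_commutator ⊤ ⊤ π).trans ?_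
    rw [Subgroup.map_top_of_surjective π hπ]
    rfl
  have hbot : commutator (BraidGroup n ⧸ K) = ⊥ := by
    refine commutator_eq_bot_of_braid (m := n - 1) (by omega) (fun i => π (σ i)) ?_
      (fun i j hij => (σ_commute i j hij).map π) (fun i j hij => ?_) ?_
    · have h := congrArg (Subgroup.map π) (PresentedGroup.closure_range_of (braidRels n))
      rw [MonoidHom.map_closure, Subgroup.map_top_of_surjective π hπ, ← Set.range_comp] at h
      exact h
    · simpa only [map_mul] using congrArg π (σ_braid i j hij)
    · rw [← hmap]
      rintro _ ⟨x, hx, rfl⟩ _ ⟨y, hy, rfl⟩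
      rw [← commutatorElement_eq_one_iff_commute, ← map_commutatorElement]
      exact (QuotientGroup.eq_one_iff _).2 (Subgroup.commutator_mem_commutator hx hy)
  have hle : commutator (BraidGroup n) ≤ K := by
    rw [← hmap, Subgroup.map_eq_bot_iff, QuotientGroup.ker_mk'] at hbot
    exact hbot
  apply Subgroup.map_injective (commutator (BraidGroup n)).subtype_injective
  refine (Subgroup.map_commutator ⊤ ⊤ _).trans ?_
  rw [← MonoidHom.range_eq_map, Subgroup.range_subtype]
  exact le_antisymm (Subgroup.commutator_le_left _ _) hle
end

section
/- For every n ≥ 2, the abelianization of J_n is a free abelian group, of rank C(n,2) + 1 if n ∈ {3,4}, and of rank C(n,2) − 1 otherwise (where C(n,2) = n(n−1)/2). -/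
namespace BraidJ

open Subgroup

section Basics

variable {m : ℕ} {G : Type*} [Group G]

/-- The Artin generator with a natural number index, extended by `1` out of range. -/
def gen (m i : ℕ) : BraidGroup (m + 2) := if h : i < m + 1 then σ (⟨i, h⟩ : Fin (m + 1)) else 1

lemma gen_of_lt {i : ℕ} (h : i < m + 1) : gen m i = σ (⟨i, h⟩ : Fin (m + 1)) := dif_pos h

lemma gen_of_le {i : ℕ} (h : m + 1 ≤ i) : gen m i = 1 := dif_neg (by omega)

lemma gen_comm {i j : ℕ} (h : i + 2 ≤ j) : Commute (gen m i) (gen m j) := by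
  rcases lt_or_ge j (m + 1) with hj | hj
  · have hi : i < m + 1 := by omega
    rw [gen_of_lt hi, gen_of_lt hj]
    have := PresentedGroup.one_of_mem (rels := braidRels (m + 2))
      (Or.inl ⟨(⟨i, hi⟩ : Fin (m + 1)), (⟨j, hj⟩ : Fin (m + 1)), h, rfl⟩)
    simp only [map_mul, map_inv] at this
    exact mul_inv_eq_one.1 (by rw [mul_inv_rev, ← mul_assoc]; exact this)
  · rw [gen_of_le hj]
    exact Commute.one_right _

lemma gen_braid {i : ℕ} (h : i + 1 < m + 1) :
    gen m i * gen m (i + 1) * gen m i = gen m (i + 1) * gen m i * gen m (i + 1) := by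
  have hi : i < m + 1 := by omega
  rw [gen_of_lt hi, gen_of_lt h]
  have := PresentedGroup.one_of_mem (rels := braidRels (m + 2))
    (Or.inr ⟨(⟨i, hi⟩ : Fin (m + 1)), (⟨i + 1, h⟩ : Fin (m + 1)), rfl, rfl⟩)
  simp only [map_mul, map_inv] at this
  exact mul_inv_eq_one.1 this

lemma closure_gen : closure (gen m '' {i | i < m + 1}) = ⊤ := by
  rw [eq_top_iff, ← PresentedGroup.closure_range_of, closure_le]
  rintro _ ⟨i, rfl⟩
  exact subset_closure ⟨(i : ℕ), i.isLt, gen_of_lt i.isLt⟩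

/-- The homomorphism from the braid group given by images of the Artin generators. -/
def lift (f : ℕ → G) (hc : ∀ i j, i + 2 ≤ j → j < m + 1 → Commute (f i) (f j))
    (hb : ∀ i, i + 1 < m + 1 → f i * f (i + 1) * f i = f (i + 1) * f i * f (i + 1)) :
    BraidGroup (m + 2) →* G :=
  PresentedGroup.toGroup (f := fun i : Fin (m + 1) => f i) (by
    rintro r (⟨i, j, h, rfl⟩ | ⟨i, j, h, rfl⟩)
    · simp only [map_mul, map_inv, FreeGroup.lift_apply_of]
      rw [(hc i j h j.isLt).eq]
      group
    · simp only [map_mul, map_inv, FreeGroup.lift_apply_of]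
      have hj : (i : ℕ) + 1 < m + 1 := h ▸ j.isLt
      rw [h, hb i hj]
      group)

lemma lift_gen (f : ℕ → G) (hc hb) {i : ℕ} (h : i < m + 1) :
    lift (m := m) f hc hb (gen m i) = f i := by
  rw [gen_of_lt h]
  exact PresentedGroup.toGroup.of _

lemma hom_ext {f g : BraidGroup (m + 2) →* G} (h : ∀ i < m + 1, f (gen m i) = g (gen m i)) :
    f = g := by
  refine PresentedGroup.ext fun i => ?_
  have := h i i.isLt
  rwa [gen_of_lt i.isLt] at this

/-- The degree (exponent sum) homomorphism. -/
def deg (m : ℕ) : BraidGroup (m + 2) →* Multiplicative ℤ :=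
  lift (fun _ => Multiplicative.ofAdd 1) (fun _ _ _ _ => Commute.all _ _) (fun _ _ => rfl)

lemma deg_gen {i : ℕ} (h : i < m + 1) : deg m (gen m i) = Multiplicative.ofAdd 1 :=
  lift_gen _ _ _ h

lemma commutator_eq_ker_deg : commutator (BraidGroup (m + 2)) = (deg m).ker := by
  refine le_antisymm (Abelianization.commutator_subset_ker _) fun g hg => ?_
  have key : (Abelianization.of : BraidGroup (m + 2) →* _) =
      (zpowersHom _ (Abelianization.of (gen m 0))).comp (deg m) := by
    refine hom_ext fun i hi => ?_
    simp only [MonoidHom.comp_apply, deg_gen hi, zpowersHom_apply, toAdd_ofAdd, zpow_one]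
    induction i with
    | zero => rfl
    | succ i ih =>
      rw [← ih (by omega)]
      have := congrArg Abelianization.of (gen_braid (m := m) hi)
      simp only [map_mul] at this
      rw [mul_comm (Abelianization.of (gen m (i + 1))) (Abelianization.of (gen m i))] at this
      exact (mul_left_cancel this).symm
  rw [← Abelianization.ker_of, MonoidHom.mem_ker, key, MonoidHom.comp_apply,
    MonoidHom.mem_ker.1 hg, map_one]

end Basics

section Winding

variable {m : ℕ}

/-- The permutation action on integer-valued functions on unordered pairs. -/
def pairAut (n : ℕ) : Equiv.Perm (Fin n) →* MulAut (Multiplicative (Sym2 (Fin n) → ℤ)) where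
  toFun g :=
    { toFun := fun f => Multiplicative.ofAdd fun a => f.toAdd (a.map ⇑g⁻¹)
      invFun := fun f => Multiplicative.ofAdd fun a => f.toAdd (a.map ⇑g)
      left_inv := fun f => by
        refine congrArg Multiplicative.ofAdd (funext fun a => congrArg f.toAdd ?_)
        simp [Sym2.map_map]
      right_inv := fun f => by
        refine congrArg Multiplicative.ofAdd (funext fun a => congrArg f.toAdd ?_)
        simp [Sym2.map_map]
      map_mul' := fun _ _ => rfl }
  map_one' := by
    ext f : 1
    refine congrArg Multiplicative.ofAdd (funext fun a => ?_)
    simp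
  map_mul' g h := by
    ext f : 1
    refine congrArg Multiplicative.ofAdd (funext fun a => ?_)
    simp [Sym2.map_map]

/-- The indicator function of an unordered pair. -/
def pairInd {n : ℕ} (a : Sym2 (Fin n)) : Multiplicative (Sym2 (Fin n) → ℤ) :=
  Multiplicative.ofAdd (Pi.single a 1)

lemma pairAut_pairInd {n : ℕ} (g : Equiv.Perm (Fin n)) (a : Sym2 (Fin n)) :
    pairAut n g (pairInd a) = pairInd (a.map g) := by
  refine congrArg Multiplicative.ofAdd (funext fun b => ?_)
  have : b.map ⇑g⁻¹ = a ↔ b = a.map g := by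
    constructor
    · rintro rfl
      simp [Sym2.map_map]
    · rintro rfl
      simp [Sym2.map_map]
  change (Pi.single a 1 : Sym2 (Fin n) → ℤ) (b.map ⇑g⁻¹) =
    (Pi.single (a.map g) 1 : Sym2 (Fin n) → ℤ) b
  simp only [Pi.single_apply, this]

/-- The strand with a natural number index. -/
def pt (m i : ℕ) : Fin (m + 2) := Fin.ofNat (m + 2) i

lemma pt_val {i : ℕ} (h : i < m + 2) : (pt m i : ℕ) = i := Nat.mod_eq_of_lt h

lemma pt_ne {i j : ℕ} (hi : i < m + 2) (hj : j < m + 2) (h : i ≠ j) : pt m i ≠ pt m j := by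
  intro e
  have := congrArg Fin.val e
  rw [pt_val hi, pt_val hj] at this
  exact h this

/-- The transposition of adjacent strands. -/
def tr (m i : ℕ) : Equiv.Perm (Fin (m + 2)) := Equiv.swap (pt m i) (pt m (i + 1))

lemma tr_left (i : ℕ) : tr m i (pt m i) = pt m (i + 1) := Equiv.swap_apply_left _ _

lemma tr_right (i : ℕ) : tr m i (pt m (i + 1)) = pt m i := Equiv.swap_apply_right _ _

lemma tr_of_ne {i j : ℕ} (hi : i + 1 < m + 2) (hj : j < m + 2) (h₁ : j ≠ i) (h₂ : j ≠ i + 1) :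
    tr m i (pt m j) = pt m j :=
  Equiv.swap_apply_of_ne_of_ne (pt_ne hj (by omega) h₁) (pt_ne hj hi h₂)

lemma pt_fin (a : Fin (m + 2)) : pt m a = a := Fin.ext (pt_val a.isLt)

/-- The homomorphism recording winding numbers (doubled on pure braids) and the permutation. -/
def wind (m : ℕ) : BraidGroup (m + 2) →*
    Multiplicative (Sym2 (Fin (m + 2)) → ℤ) ⋊[pairAut (m + 2)] Equiv.Perm (Fin (m + 2)) :=
  lift (fun i => ⟨pairInd s(pt m i, pt m (i + 1)), tr m i⟩)
    (by
      intro i j hij hj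
      have h₁ := tr_of_ne (m := m) (i := i) (j := j) (by omega) (by omega) (by omega) (by omega)
      have h₂ := tr_of_ne (m := m) (i := i) (j := j + 1) (by omega) (by omega) (by omega) (by omega)
      have h₃ := tr_of_ne (m := m) (i := j) (j := i) (by omega) (by omega) (by omega) (by omega)
      have h₄ := tr_of_ne (m := m) (i := j) (j := i + 1) (by omega) (by omega) (by omega) (by omega)
      refine SemidirectProduct.ext ?_ ?_
      · simp only [SemidirectProduct.mul_left, pairAut_pairInd, Sym2.map_mk, h₁, h₂, h₃, h₄]
        exact mul_comm _ _
      · simp only [SemidirectProduct.mul_right]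
        rw [tr, tr, Equiv.mul_swap_eq_swap_mul, ← tr, ← tr, h₁, h₂, ← tr])
    (by
      intro i hi
      have h₁ := tr_of_ne (m := m) (i := i) (j := i + 1 + 1) (by omega) (by omega) (by omega)
        (by omega)
      have h₂ := tr_of_ne (m := m) (i := i + 1) (j := i) (by omega) (by omega) (by omega) (by omega)
      refine SemidirectProduct.ext ?_ ?_
      · simp only [SemidirectProduct.mul_left, SemidirectProduct.mul_right, pairAut_pairInd,
          Sym2.map_mk, Equiv.Perm.mul_apply, tr_left, tr_right, h₁, h₂]
        rw [mul_comm _ (pairInd s(pt m (i + 1), pt m (i + 1 + 1))),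
          mul_comm (pairInd s(pt m i, pt m (i + 1))), ← mul_assoc]
      · simp only [SemidirectProduct.mul_right]
        change tr m i * tr m (i + 1) * Equiv.swap (pt m i) (pt m (i + 1)) = _
        rw [Equiv.mul_swap_eq_swap_mul, Equiv.Perm.mul_apply, Equiv.Perm.mul_apply, h₂, tr_left,
          tr_left, h₁]
        exact (mul_assoc (tr m (i + 1)) (tr m i) _).symm)

end Winding

section Coxeter

variable {m : ℕ} {W : Type*} [Group W]

/-- The descending product `s k * s (k - 1) * ⋯` with `l` factors. -/
def desc (s : ℕ → W) (k : ℕ) : ℕ → W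
  | 0 => 1
  | l + 1 => desc s k l * s (k - l)

lemma desc_comm {s : ℕ → W} (hc : ∀ i j, i + 2 ≤ j → Commute (s i) (s j)) {k i l : ℕ}
    (h : i + l < k) : Commute (s i) (desc s k l) := by
  induction l with
  | zero => exact Commute.one_right _
  | succ l ih => exact (ih (by omega)).mul_right (hc _ _ (by omega))

lemma desc_shift {s : ℕ → W} (hc : ∀ i j, i + 2 ≤ j → Commute (s i) (s j))
    (hb : ∀ i, i + 1 < m + 1 → s i * s (i + 1) * s i = s (i + 1) * s i * s (i + 1)) {k l : ℕ}
    (hk : k < m + 1) :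
    ∀ {i : ℕ}, i ≤ k → l ≤ k + 1 → k + 1 < i + l → desc s k l * s i = s (i - 1) * desc s k l := by
  induction l with
  | zero => intro i _ _ h; omega
  | succ l ih =>
    intro i hi hl h
    rcases lt_or_ge (k + 1) (i + l) with h' | h'
    · rw [desc, mul_assoc, (hc (k - l) i (by omega)).eq, ← mul_assoc, ih hi (by omega) h',
        mul_assoc]
    · obtain ⟨j, rfl⟩ : ∃ j, l = j + 1 := ⟨l - 1, by omega⟩
      obtain ⟨i, rfl⟩ : ∃ j, i = j + 1 := ⟨i - 1, by omega⟩
      have e₁ : k - (j + 1) = i := by omega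
      have e₂ : k - j = i + 1 := by omega
      rw [desc, desc, e₁, e₂, Nat.add_sub_cancel]
      calc desc s k j * s (i + 1) * s i * s (i + 1)
          = desc s k j * (s (i + 1) * s i * s (i + 1)) := by simp only [mul_assoc]
        _ = desc s k j * s i * (s (i + 1) * s i) := by
          rw [← hb i (by omega)]
          simp only [mul_assoc]
        _ = _ := by
          rw [← (desc_comm hc (i := i) (by omega)).eq]
          simp only [mul_assoc]

lemma exists_eq_mul_desc {s : ℕ → W} (hc : ∀ i j, i + 2 ≤ j → Commute (s i) (s j))
    (hb : ∀ i, i + 1 < m + 1 → s i * s (i + 1) * s i = s (i + 1) * s i * s (i + 1))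
    (hs : ∀ i, s i * s i = 1) {k : ℕ} (hk : k < m + 1) {w : W}
    (hw : w ∈ closure (s '' {i | i < k + 1})) :
    ∃ l ≤ k + 1, ∃ w' ∈ closure (s '' {i | i < k}), w = w' * desc s k l := by
  have step : ∀ i ≤ k, ∀ w : W,
      (∃ l ≤ k + 1, ∃ w' ∈ closure (s '' {i | i < k}), w = w' * desc s k l) →
      ∃ l ≤ k + 1, ∃ w' ∈ closure (s '' {i | i < k}), w * s i = w' * desc s k l := by
    rintro i hi _ ⟨l, hl, w', hw', rfl⟩
    rcases lt_trichotomy (i + l) k with h | h | h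
    · refine ⟨l, hl, w' * s i, mul_mem hw' (subset_closure ⟨i, by simp; omega, rfl⟩), ?_⟩
      rw [mul_assoc, mul_assoc, (desc_comm hc h).eq]
    · refine ⟨l + 1, by omega, w', hw', ?_⟩
      rw [desc, mul_assoc, show k - l = i by omega]
    · rcases eq_or_ne (i + l) (k + 1) with h' | h'
      · obtain ⟨j, rfl⟩ : ∃ j, l = j + 1 := ⟨l - 1, by omega⟩
        refine ⟨j, by omega, w', hw', ?_⟩
        rw [desc, show k - j = i by omega, mul_assoc, mul_assoc, hs, mul_one]
      · refine ⟨l, hl, w' * s (i - 1),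
          mul_mem hw' (subset_closure ⟨i - 1, by simp; omega, rfl⟩), ?_⟩
        rw [mul_assoc, mul_assoc, desc_shift hc hb hk hi hl (by omega)]
  induction hw using closure_induction_right with
  | one => exact ⟨0, by omega, 1, one_mem _, by simp [desc]⟩
  | mul_right w _ y hy ih =>
    obtain ⟨i, hi, rfl⟩ := hy
    exact step i (Nat.lt_succ_iff.1 hi) w ih
  | mul_inv_cancel w _ y hy ih =>
    obtain ⟨i, hi, rfl⟩ := hy
    rw [inv_eq_of_mul_eq_one_left (hs i)]
    exact step i (Nat.lt_succ_iff.1 hi) w ih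

lemma perm_desc {s : ℕ → W} {p : W →* Equiv.Perm (Fin (m + 2))}
    (hp : ∀ i < m + 1, p (s i) = tr m i) {k l : ℕ} (hk : k < m + 1) (hl : l ≤ k + 1) :
    p (desc s k l) (pt m (k + 1 - l)) = pt m (k + 1) := by
  induction l with
  | zero => simp [desc]
  | succ l ih =>
    rw [desc, map_mul, hp _ (by omega), Equiv.Perm.mul_apply,
      show k + 1 - (l + 1) = k - l by omega, tr_left, show k - l + 1 = k + 1 - l by omega]
    exact ih (by omega)

lemma perm_fix {s : ℕ → W} {p : W →* Equiv.Perm (Fin (m + 2))}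
    (hp : ∀ i < m + 1, p (s i) = tr m i) {k : ℕ} (hk : k < m + 1) {w : W}
    (hw : w ∈ closure (s '' {i | i < k})) : p w (pt m (k + 1)) = pt m (k + 1) := by
  have : closure (s '' {i | i < k}) ≤
      (MulAction.stabilizer (Equiv.Perm (Fin (m + 2))) (pt m (k + 1))).comap p := by
    rw [closure_le]
    rintro _ ⟨i, hi, rfl⟩
    have hi' : i < k := hi
    change p (s i) (pt m (k + 1)) = _
    rw [hp _ (by omega)]
    exact tr_of_ne (by omega) (by omega) (by omega) (by omega)
  exact this hw

/-- A group generated by involutions satisfying the braid relations maps injectively to the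
symmetric group. -/
lemma eq_one_of_perm_eq_one {s : ℕ → W} (hc : ∀ i j, i + 2 ≤ j → Commute (s i) (s j))
    (hb : ∀ i, i + 1 < m + 1 → s i * s (i + 1) * s i = s (i + 1) * s i * s (i + 1))
    (hs : ∀ i, s i * s i = 1) {p : W →* Equiv.Perm (Fin (m + 2))}
    (hp : ∀ i < m + 1, p (s i) = tr m i) {k : ℕ} (hk : k ≤ m + 1) {w : W}
    (hw : w ∈ closure (s '' {i | i < k})) (h1 : p w = 1) : w = 1 := by
  induction k generalizing w with
  | zero => simpa using hw
  | succ k ih =>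
    obtain ⟨l, hl, w', hw', rfl⟩ := exists_eq_mul_desc hc hb hs (by omega) hw
    have e : p (w' * desc s k l) (pt m (k + 1 - l)) = pt m (k + 1 - l) := by rw [h1]; rfl
    rw [map_mul, Equiv.Perm.mul_apply, perm_desc hp (by omega) hl, perm_fix hp (by omega) hw'] at e
    have : l = 0 := by
      by_contra h0
      exact pt_ne (m := m) (by omega) (by omega) (by omega) e
    subst this
    rw [desc, mul_one] at h1 ⊢
    exact ih (by omega) hw' h1

end Coxeter

section Pure

variable {m : ℕ}

/-- The permutation homomorphism. -/
def perm (m : ℕ) : BraidGroup (m + 2) →* Equiv.Perm (Fin (m + 2)) :=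
  SemidirectProduct.rightHom.comp (wind m)

lemma wind_gen {i : ℕ} (h : i < m + 1) :
    wind m (gen m i) = ⟨pairInd s(pt m i, pt m (i + 1)), tr m i⟩ := lift_gen _ _ _ h

lemma perm_gen {i : ℕ} (h : i < m + 1) : perm m (gen m i) = tr m i := by
  rw [perm, MonoidHom.comp_apply, wind_gen h]
  rfl

/-- The square of the first Artin generator. -/
def sq (m : ℕ) : BraidGroup (m + 2) := gen m 0 * gen m 0

lemma gen_succ_conj {i : ℕ} (h : i + 1 < m + 1) :
    gen m (i + 1) = (gen m i * gen m (i + 1)) * gen m i * (gen m i * gen m (i + 1))⁻¹ := by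
  rw [gen_braid h, eq_mul_inv_iff_mul_eq]
  group

lemma exists_gen_sq_eq_conj {i : ℕ} (h : i < m + 1) :
    ∃ g, gen m i * gen m i = g * sq m * g⁻¹ := by
  induction i with
  | zero => exact ⟨1, by simp [sq]⟩
  | succ i ih =>
    obtain ⟨g, hg⟩ := ih (by omega)
    refine ⟨gen m i * gen m (i + 1) * g, ?_⟩
    have : gen m (i + 1) * gen m (i + 1) =
        (gen m i * gen m (i + 1)) * (gen m i * gen m i) * (gen m i * gen m (i + 1))⁻¹ := by
      conv_lhs => rw [gen_succ_conj h]
      group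
    rw [this, hg]
    group

lemma map_eq_one_of_perm {W : Type*} [Group W] (π : BraidGroup (m + 2) →* W)
    (p : W →* Equiv.Perm (Fin (m + 2))) (hp : ∀ g, p (π g) = perm m g) (h1 : π (sq m) = 1)
    {q : BraidGroup (m + 2)} (hq : perm m q = 1) : π q = 1 := by
  refine eq_one_of_perm_eq_one (m := m) (s := fun i => π (gen m i)) (p := p) ?_ ?_ ?_ ?_
    le_rfl ?_ ((hp q).trans hq)
  · exact fun i j h => (gen_comm h).map _
  · exact fun i h => by simp only [← map_mul, gen_braid h]
  · intro i
    rcases lt_or_ge i (m + 1) with h | h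
    · obtain ⟨g, hg⟩ := exists_gen_sq_eq_conj h
      rw [← map_mul, hg]
      simp [h1]
    · simp [gen_of_le h]
  · exact fun i h => (hp _).trans (perm_gen h)
  · have h := Subgroup.mem_map_of_mem π (mem_top q)
    rw [← closure_gen, MonoidHom.map_closure] at h
    rwa [← Set.image_image]

/-- Pure braids form the normal closure of the square of a generator. -/
lemma ker_perm_le : (perm m).ker ≤ closure (Set.range fun g => g * sq m * g⁻¹) := by
  intro q hq
  have e : closure (Set.range fun g => g * sq m * g⁻¹) = normalClosure {sq m} := by
    rw [normalClosure, Group.conjugatesOfSet]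
    congr 1
    ext z
    simp [conjugatesOf, isConj_iff]
  rw [e]
  have hle : normalClosure {sq m} ≤ (perm m).ker := by
    refine normalClosure_le_normal ?_
    rintro _ rfl
    rw [SetLike.mem_coe, MonoidHom.mem_ker, sq, map_mul, perm_gen (by omega), tr,
      Equiv.swap_mul_self]
  have key := map_eq_one_of_perm (QuotientGroup.mk' (normalClosure {sq m}))
    (QuotientGroup.lift _ (perm m) hle) (fun g => QuotientGroup.lift_mk' _ hle g)
    ((QuotientGroup.eq_one_iff _).2 (subset_normalClosure rfl)) (MonoidHom.mem_ker.1 hq)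
  exact (QuotientGroup.eq_one_iff _).1 key

end Pure

section PureAbelianization

variable {m : ℕ} {G : Type*} [Group G]

lemma pt_succ_mem_orbit {i : ℕ} (h : i < m + 1) (h₁ : i ≠ 1) :
    pt m (i + 1) ∈ MulAction.orbit (closure (tr m '' {i | i < m + 1 ∧ i ≠ 1})) (pt m i) :=
  ⟨⟨tr m i, subset_closure ⟨i, ⟨h, h₁⟩, rfl⟩⟩, tr_left i⟩

lemma tr_isSwap {i : ℕ} (h : i < m + 1) : (tr m i).IsSwap :=
  ⟨_, _, pt_ne (by omega) (by omega) (by omega), rfl⟩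

lemma pt_mem_orbit {i : ℕ} (h : i + 2 < m + 2) :
    pt m (i + 2) ∈ MulAction.orbit (closure (tr m '' {i | i < m + 1 ∧ i ≠ 1})) (pt m 2) := by
  induction i with
  | zero => exact MulAction.mem_orbit_self _
  | succ i ih =>
    rw [← MulAction.orbit_eq_iff.2 (ih (by omega))]
    exact pt_succ_mem_orbit (by omega) (by omega)

/-- The stabilizer of a pair of adjacent points is generated by adjacent transpositions. -/
lemma mem_closure_of_map_eq {τ : Equiv.Perm (Fin (m + 2))}
    (h : s(pt m 0, pt m 1).map τ = s(pt m 0, pt m 1)) :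
    τ ∈ closure (tr m '' {i | i < m + 1 ∧ i ≠ 1}) := by
  rw [mem_closure_isSwap (by rintro _ ⟨i, hi, rfl⟩; exact tr_isSwap hi.1)]
  refine ⟨Set.toFinite _, fun x => ?_⟩
  have h01 := pt_succ_mem_orbit (m := m) (i := 0) (by omega) (by omega)
  rw [zero_add] at h01
  rw [Sym2.map_mk, Sym2.eq_iff] at h
  have big : ∀ y : Fin (m + 2), y ≠ pt m 0 → y ≠ pt m 1 →
      y ∈ MulAction.orbit (closure (tr m '' {i | i < m + 1 ∧ i ≠ 1})) (pt m 2) := by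
    intro y h0 h1
    obtain ⟨y, hy⟩ := y
    match y, hy with
    | 0, hy => exact absurd (pt_fin ⟨0, hy⟩).symm h0
    | 1, hy => exact absurd (pt_fin ⟨1, hy⟩).symm h1
    | y + 2, hy =>
      rw [← pt_fin ⟨y + 2, hy⟩]
      exact pt_mem_orbit hy
  by_cases hx0 : x = pt m 0
  · subst hx0
    rcases h with h | h
    · rw [h.1]
      exact MulAction.mem_orbit_self _
    · rw [h.1]
      exact h01
  by_cases hx1 : x = pt m 1
  · subst hx1
    rcases h with h | h
    · rw [h.2]
      exact MulAction.mem_orbit_self _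
    · rw [h.2]
      exact MulAction.mem_orbit_symm.1 h01
  · rw [MulAction.orbit_eq_iff.2 (big x hx0 hx1)]
    apply big
    · rcases h with h | h
      · rw [← h.1]
        exact fun e => hx0 (τ.injective e)
      · rw [← h.2]
        exact fun e => hx1 (τ.injective e)
    · rcases h with h | h
      · rw [← h.2]
        exact fun e => hx1 (τ.injective e)
      · rw [← h.1]
        exact fun e => hx0 (τ.injective e)

lemma perm_surjective : Function.Surjective (perm m) := by
  have : (perm m).range = ⊤ := by
    rw [MonoidHom.range_eq_map, ← closure_gen, MonoidHom.map_closure, Set.image_image, eq_top_iff]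
    intro τ _
    have e : (fun i => perm m (gen m i)) '' {i | i < m + 1} = tr m '' {i | i < m + 1} :=
      Set.image_congr fun i hi => perm_gen hi
    rw [e, mem_closure_isSwap (by rintro _ ⟨i, hi, rfl⟩; exact tr_isSwap hi)]
    refine ⟨Set.toFinite _, fun x => ?_⟩
    have key : ∀ i, i < m + 2 →
        pt m i ∈ MulAction.orbit (closure (tr m '' {i | i < m + 1})) (pt m 0) := by
      intro i hi
      induction i with
      | zero => exact MulAction.mem_orbit_self _
      | succ i ih =>
        rw [← MulAction.orbit_eq_iff.2 (ih (by omega))]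
        exact ⟨⟨tr m i, subset_closure ⟨i, by simp; omega, rfl⟩⟩, tr_left i⟩
    rw [← pt_fin x, ← pt_fin (τ (pt m x)), MulAction.orbit_eq_iff.2 (key x x.isLt)]
    exact key _ (Fin.isLt _)
  exact MonoidHom.range_eq_top.1 this

/-- The squared generator is a pure braid. -/
lemma sq_mem : sq m ∈ (perm m).ker := by
  rw [MonoidHom.mem_ker, sq, map_mul, perm_gen (by omega), tr, Equiv.swap_mul_self]

lemma conj_sq_mem (g : BraidGroup (m + 2)) : g * sq m * g⁻¹ ∈ (perm m).ker :=
  (MonoidHom.normal_ker _).conj_mem _ sq_mem g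

lemma gen_comm_sq {i : ℕ} (h : i ≠ 1) : Commute (gen m i) (sq m) := by
  rcases Nat.eq_zero_or_pos i with rfl | h0
  · exact (Commute.refl _).mul_right (Commute.refl _)
  · exact ((gen_comm (by omega)).mul_left (gen_comm (by omega))).symm

lemma commute_sq_of_map_eq {π : BraidGroup (m + 2) →* G}
    (hπ : ∀ p ∈ (perm m).ker, ∀ q ∈ (perm m).ker, Commute (π p) (π q)) {g : BraidGroup (m + 2)}
    (h : s(pt m 0, pt m 1).map (perm m g) = s(pt m 0, pt m 1)) : Commute (π g) (π (sq m)) := by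
  have h' := mem_closure_of_map_eq h
  have e : (fun i => perm m (gen m i)) '' {i | i < m + 1 ∧ i ≠ 1} =
      tr m '' {i | i < m + 1 ∧ i ≠ 1} :=
    Set.image_congr fun i hi => perm_gen hi.1
  rw [← e, ← Set.image_image, ← MonoidHom.map_closure] at h'
  obtain ⟨k, hk, hkg⟩ := h'
  have hle : closure (gen m '' {i | i < m + 1 ∧ i ≠ 1}) ≤ (centralizer {sq m}) := by
    rw [closure_le]
    rintro _ ⟨i, hi, rfl⟩
    exact mem_centralizer_singleton_iff.2 (gen_comm_sq hi.2).eq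
  have h₁ : Commute (π k) (π (sq m)) :=
    Commute.map (mem_centralizer_singleton_iff.1 (hle hk)) π
  have h₂ : Commute (π (k⁻¹ * g)) (π (sq m)) :=
    hπ _ (by rw [MonoidHom.mem_ker, map_mul, map_inv, hkg, inv_mul_cancel]) _ sq_mem
  have := h₁.mul_left h₂
  rwa [← map_mul, mul_inv_cancel_left] at this

lemma map_conj_eq_of_map_eq {π : BraidGroup (m + 2) →* G}
    (hπ : ∀ p ∈ (perm m).ker, ∀ q ∈ (perm m).ker, Commute (π p) (π q)) {g h : BraidGroup (m + 2)}
    (e : s(pt m 0, pt m 1).map (perm m g) = s(pt m 0, pt m 1).map (perm m h)) :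
    π (g * sq m * g⁻¹) = π (h * sq m * h⁻¹) := by
  have := commute_sq_of_map_eq hπ (g := h⁻¹ * g) (by
    rw [map_mul, Equiv.Perm.coe_mul, ← Sym2.map_map, e, Sym2.map_map, ← Equiv.Perm.coe_mul,
      ← map_mul, inv_mul_cancel, map_one, Equiv.Perm.coe_one, Sym2.map_id, id])
  have e' : π (h⁻¹ * g) * π (sq m) * (π (h⁻¹ * g))⁻¹ = π (sq m) := by
    rw [this.eq, mul_inv_cancel_right]
  simp only [map_mul, map_inv] at e' ⊢
  conv_rhs => rw [← e']
  group

/-- The doubled winding numbers of a pure braid. -/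
def pureWind (m : ℕ) : (perm m).ker →* Multiplicative (Sym2 (Fin (m + 2)) → ℤ) where
  toFun g := (wind m g).left
  map_one' := by simp
  map_mul' g h := by
    have : (wind m g).right = 1 := g.2
    simp [this]

lemma wind_conj (g : BraidGroup (m + 2)) :
    (wind m (g * sq m * g⁻¹)).left = pairInd (s(pt m 0, pt m 1).map (perm m g)) ^ 2 := by
  have e : wind m (sq m) = SemidirectProduct.inl (pairInd s(pt m 0, pt m 1) ^ 2) := by
    rw [sq, map_mul, wind_gen (by omega)]
    refine SemidirectProduct.ext ?_ ?_
    · rw [SemidirectProduct.mul_left, pairAut_pairInd, Sym2.map_mk, tr_left, tr_right,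
        Sym2.eq_swap, SemidirectProduct.left_inl, pow_two]
    · rw [SemidirectProduct.mul_right, tr, Equiv.swap_mul_self, SemidirectProduct.right_inl]
  have e' : pairAut (m + 2) (wind m g).right (pairInd s(pt m 0, pt m 1) ^ 2) =
      pairInd (s(pt m 0, pt m 1).map (perm m g)) ^ 2 := by
    rw [map_pow]
    exact congrArg (· ^ 2) (pairAut_pairInd _ _)
  rw [← e']
  generalize pairInd s(pt m 0, pt m 1) ^ 2 = N at e
  rw [map_mul, map_mul, e, map_inv]
  simp only [SemidirectProduct.mul_left, SemidirectProduct.mul_right, SemidirectProduct.left_inl,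
    SemidirectProduct.right_inl, mul_one, SemidirectProduct.inv_left, map_inv,
    MulAut.apply_inv_self]
  rw [mul_comm, inv_mul_cancel_left]

lemma sum_wind (g : BraidGroup (m + 2)) :
    ∑ a, (wind m g).left.toAdd a = (deg m g).toAdd := by
  let S : BraidGroup (m + 2) →* Multiplicative ℤ :=
    { toFun := fun g => Multiplicative.ofAdd (∑ a, (wind m g).left.toAdd a)
      map_one' := by simp
      map_mul' := fun g h => by
        rw [map_mul, SemidirectProduct.mul_left, ← ofAdd_add]
        refine congrArg Multiplicative.ofAdd ?_
        rw [toAdd_mul]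
        simp only [Pi.add_apply, Finset.sum_add_distrib]
        congr 1
        exact Fintype.sum_equiv
          ⟨Sym2.map ⇑(wind m g).right⁻¹, Sym2.map ⇑(wind m g).right,
            fun a => by simp [Sym2.map_map], fun a => by simp [Sym2.map_map]⟩ _ _ fun _ => rfl }
  have : S = deg m := by
    refine hom_ext fun i hi => ?_
    rw [deg_gen hi]
    refine congrArg Multiplicative.ofAdd ?_
    rw [wind_gen hi]
    simp [pairInd]
  exact congrArg Multiplicative.toAdd (DFunLike.congr_fun this g)

/-- Winding numbers detect the abelianization of the pure braid group. -/
lemma mem_commutator_of_wind {p : BraidGroup (m + 2)} (hp : p ∈ (perm m).ker)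
    (h : (wind m p).left = 1) : p ∈ ⁅(perm m).ker, (perm m).ker⁆ := by
  classical
  set C := ⁅(perm m).ker, (perm m).ker⁆ with hC
  let ρ : (perm m).ker →* Abelianization (perm m).ker := Abelianization.of
  have hρ : ∀ q : (perm m).ker, ρ q = 1 → (q : BraidGroup (m + 2)) ∈ C := by
    intro q hq
    rw [hC, ← map_subtype_commutator]
    exact ⟨q, by rwa [SetLike.mem_coe, ← Abelianization.ker_of], rfl⟩
  have hρ' : ∀ q : (perm m).ker, (q : BraidGroup (m + 2)) ∈ C → ρ q = 1 := by
    intro q hq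
    rw [hC, ← map_subtype_commutator] at hq
    obtain ⟨q', hq', e⟩ := hq
    rw [SetLike.mem_coe, ← Abelianization.ker_of] at hq'
    rwa [← Subtype.ext e]
  let E (g : BraidGroup (m + 2)) : (perm m).ker := ⟨g * sq m * g⁻¹, conj_sq_mem g⟩
  have hE : ∀ g h, s(pt m 0, pt m 1).map (perm m g) = s(pt m 0, pt m 1).map (perm m h) →
      ρ (E g) = ρ (E h) := by
    intro g h e
    have := map_conj_eq_of_map_eq (π := QuotientGroup.mk' C) (by
      intro p hp q hq
      rw [commute_iff_eq, ← map_mul, ← map_mul]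
      refine QuotientGroup.eq.2 ?_
      have := commutator_mem_commutator (inv_mem hq) (inv_mem hp)
      rw [commutatorElement_def] at this
      convert! this using 1
      group) e
    have := hρ' ((E g)⁻¹ * E h) (QuotientGroup.eq.1 this)
    rw [map_mul, map_inv, inv_mul_eq_one] at this
    exact this
  let A (a : Sym2 (Fin (m + 2))) : Abelianization (perm m).ker :=
    if h : ∃ g, s(pt m 0, pt m 1).map (perm m g) = a then ρ (E h.choose) else 1
  have hA : ∀ g, A (s(pt m 0, pt m 1).map (perm m g)) = ρ (E g) := by
    intro g
    have h : ∃ g', s(pt m 0, pt m 1).map (perm m g') = s(pt m 0, pt m 1).map (perm m g) := ⟨g, rfl⟩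
    exact (dif_pos h).trans (hE _ _ h.choose_spec)
  let Θ (v : Sym2 (Fin (m + 2)) → ℤ) : Abelianization (perm m).ker := ∏ a, A a ^ v a
  have key : ∃ hp : p ∈ (perm m).ker, ∃ v : Sym2 (Fin (m + 2)) → ℤ,
      (wind m p).left.toAdd = v + v ∧ ρ ⟨p, hp⟩ = Θ v := by
    have hp' := ker_perm_le hp
    clear h hp
    induction hp' using closure_induction with
    | mem _ h =>
      obtain ⟨g, rfl⟩ := h
      refine ⟨conj_sq_mem g, Pi.single (s(pt m 0, pt m 1).map (perm m g)) 1, ?_, ?_⟩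
      · simp only
        rw [wind_conj, pow_two]
        rfl
      · refine (hA g).symm.trans ?_
        simp only [Θ]
        rw [Finset.prod_eq_single (s(pt m 0, pt m 1).map (perm m g))]
        · simp
        · intro b _ hb
          rw [Pi.single_eq_of_ne hb, zpow_zero]
        · simp
    | one =>
      refine ⟨one_mem _, 0, by simp, ?_⟩
      simp only [Θ, Pi.zero_apply, zpow_zero, Finset.prod_const_one]
      exact map_one ρ
    | mul x y _ _ hx hy =>
      obtain ⟨hx, v, hv, hv'⟩ := hx
      obtain ⟨hy, w, hw, hw'⟩ := hy
      refine ⟨mul_mem hx hy, v + w, ?_, ?_⟩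
      · have := congrArg Multiplicative.toAdd ((pureWind m).map_mul ⟨x, hx⟩ ⟨y, hy⟩)
        change (wind m (x * y)).left.toAdd = (wind m x).left.toAdd + (wind m y).left.toAdd at this
        rw [this, hv, hw]
        abel
      · change ρ (⟨x, hx⟩ * ⟨y, hy⟩) = _
        rw [map_mul, hv', hw']
        simp only [Θ, Pi.add_apply, zpow_add, Finset.prod_mul_distrib]
    | inv x _ hx =>
      obtain ⟨hx, v, hv, hv'⟩ := hx
      refine ⟨inv_mem hx, -v, ?_, ?_⟩
      · have := congrArg Multiplicative.toAdd ((pureWind m).map_inv ⟨x, hx⟩)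
        change (wind m (x⁻¹)).left.toAdd = -(wind m x).left.toAdd at this
        rw [this, hv]
        abel
      · change ρ (⟨x, hx⟩⁻¹) = _
        rw [map_inv, hv']
        simp only [Θ, Pi.neg_apply, zpow_neg, Finset.prod_inv_distrib]
  obtain ⟨hp', v, hv, hv'⟩ := key
  have v0 : v = 0 := by
    funext a
    have := congrFun hv a
    rw [h] at this
    simp only [toAdd_one, Pi.zero_apply, Pi.add_apply] at this ⊢
    omega
  refine hρ ⟨p, hp⟩ ?_
  rw [hv', v0]
  simp [Θ]

end PureAbelianization

section Commutation

variable {m : ℕ} {G : Type*} [Group G]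

/-- The degree-zero pure braids. -/
def zeroPure (m : ℕ) : Subgroup (BraidGroup (m + 2)) := (deg m).ker ⊓ (perm m).ker

lemma inv_mul_mem_zeroPure {p q : BraidGroup (m + 2)} (hp : p ∈ (perm m).ker)
    (hq : q ∈ (perm m).ker) (h : deg m p = deg m q) : p⁻¹ * q ∈ zeroPure m :=
  mem_inf.2 ⟨by rw [MonoidHom.mem_ker, map_mul, map_inv, h, inv_mul_cancel],
    mul_mem (inv_mem hp) hq⟩

variable {π : BraidGroup (m + 2) →* G}

/-- Commutation is transitive on pure braids of equal degree, modulo the commutator subgroup of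
the degree-zero pure braids. -/
lemma commute_trans
    (hπ : ∀ a ∈ zeroPure m, ∀ b ∈ zeroPure m, Commute (π a) (π b))
    {a b c : BraidGroup (m + 2)} (ha : a ∈ (perm m).ker) (hb : b ∈ (perm m).ker)
    (hc : c ∈ (perm m).ker) (hab : deg m a = deg m b) (hbc : deg m b = deg m c)
    (h₁ : Commute (π a) (π b)) (h₂ : Commute (π b) (π c)) : Commute (π a) (π c) := by
  have h := hπ _ (inv_mul_mem_zeroPure hb ha hab.symm) _ (inv_mul_mem_zeroPure hb hc hbc)
  simp only [map_mul, map_inv] at h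
  have e₁ : Commute (π b) ((π b)⁻¹ * π a) := (Commute.refl _).inv_right.mul_right h₁.symm
  have e₂ : Commute (π b) ((π b)⁻¹ * π c) := (Commute.refl _).inv_right.mul_right h₂
  have := (((Commute.refl (π b)).mul_right e₂).mul_left (e₁.symm.mul_right h))
  simpa only [mul_inv_cancel_left] using this

/-- Pure braids of equal degree act in the same way on degree-zero pure braids. -/
lemma conj_eq_conj
    (hπ : ∀ a ∈ zeroPure m, ∀ b ∈ zeroPure m, Commute (π a) (π b))
    {p q j : BraidGroup (m + 2)} (hp : p ∈ (perm m).ker) (hq : q ∈ (perm m).ker)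
    (h : deg m p = deg m q) (hj : j ∈ zeroPure m) :
    π p * π j * (π p)⁻¹ = π q * π j * (π q)⁻¹ := by
  have h := hπ _ (inv_mul_mem_zeroPure hp hq h) _ hj
  simp only [map_mul, map_inv] at h
  have e : π q * π j * (π q)⁻¹ = π p * ((π p)⁻¹ * π q * π j) * (π q)⁻¹ := by group
  rw [e, h.eq]
  group

lemma deg_conj (g q : BraidGroup (m + 2)) : deg m (g * q * g⁻¹) = deg m q := by
  rw [map_mul, map_mul, map_inv, mul_comm (deg m g), mul_inv_cancel_right]

/-- If the square of a generator commutes with its conjugates by generators, then pure braids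
commute. -/
lemma commute_of_gen_conj
    (hπ : ∀ a ∈ zeroPure m, ∀ b ∈ zeroPure m, Commute (π a) (π b))
    (h : ∀ i < m + 1, Commute (π (gen m i * sq m * (gen m i)⁻¹)) (π (sq m))) :
    ∀ p ∈ (perm m).ker, ∀ q ∈ (perm m).ker, Commute (π p) (π q) := by
  have conj : ∀ g a b : BraidGroup (m + 2), Commute (π a) (π b) →
      Commute (π (g * a * g⁻¹)) (π (g * b * g⁻¹)) := by
    intro g a b hab
    simp only [map_mul, map_inv]
    exact (Commute.conj_iff (π g)).2 hab
  have step : ∀ g, Commute (π (g * sq m * g⁻¹)) (π (sq m)) := by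
    intro g
    have hg : g ∈ closure (gen m '' {i | i < m + 1}) := by rw [closure_gen]; trivial
    induction hg using closure_induction_left with
    | one => simp
    | mul_left x hx y _ ih =>
      obtain ⟨i, hi, rfl⟩ := hx
      have := conj (gen m i) _ _ ih
      refine commute_trans hπ (conj_sq_mem _) (conj_sq_mem (gen m i)) sq_mem ?_ ?_ ?_ (h i hi)
      · simp only [deg_conj]
      · simp only [deg_conj]
      · convert! this using 2
        group
    | inv_mul_cancel x hx y _ ih =>
      obtain ⟨i, hi, rfl⟩ := hx
      have h₁ := conj (gen m i)⁻¹ _ _ ih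
      have h₂ := conj (gen m i)⁻¹ _ _ (h i hi)
      refine commute_trans hπ (conj_sq_mem _) (conj_sq_mem (gen m i)⁻¹) sq_mem ?_ ?_ ?_ ?_
      · simp only [deg_conj]
      · simp only [deg_conj]
      · convert! h₁ using 2
        group
      · convert! h₂.symm using 2
        group
  have step' : ∀ g k, Commute (π (g * sq m * g⁻¹)) (π (k * sq m * k⁻¹)) := fun g k =>
    commute_trans hπ (conj_sq_mem _) sq_mem (conj_sq_mem _) (by simp only [deg_conj])
      (by simp only [deg_conj]) (step g) (step k).symm
  have one : ∀ q ∈ (perm m).ker, ∀ g, Commute (π (g * sq m * g⁻¹)) (π q) := by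
    intro q hq g
    have hle : closure (Set.range fun g => g * sq m * g⁻¹) ≤
        (centralizer {π (g * sq m * g⁻¹)}).comap π := by
      rw [closure_le]
      rintro _ ⟨k, rfl⟩
      exact mem_centralizer_singleton_iff.2 (step' k g).eq
    exact (show Commute _ _ from mem_centralizer_singleton_iff.1 (hle (ker_perm_le hq))).symm
  intro p hp q hq
  have hle : closure (Set.range fun g => g * sq m * g⁻¹) ≤ (centralizer {π q}).comap π := by
    rw [closure_le]
    rintro _ ⟨k, rfl⟩
    exact mem_centralizer_singleton_iff.2 (one q hq k).eq
  exact mem_centralizer_singleton_iff.1 (hle (ker_perm_le hp))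

lemma gen_conj_sq {i : ℕ} (h : i ≠ 1) : gen m i * sq m * (gen m i)⁻¹ = sq m := by
  rw [(gen_comm_sq h).eq, mul_inv_cancel_right]

/-- For a number of strings other than three and four, pure braids commute modulo the commutator
subgroup of the degree-zero pure braids. -/
lemma commute_of_ne
    (hπ : ∀ a ∈ zeroPure m, ∀ b ∈ zeroPure m, Commute (π a) (π b))
    (hm : m = 0 ∨ 3 ≤ m) :
    ∀ p ∈ (perm m).ker, ∀ q ∈ (perm m).ker, Commute (π p) (π q) := by
  refine commute_of_gen_conj hπ fun i hi => ?_
  rcases eq_or_ne i 1 with rfl | h1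
  · have hm : 3 ≤ m := by omega
    have hz : gen m 3 * gen m 3 ∈ (perm m).ker := by
      rw [MonoidHom.mem_ker, map_mul, perm_gen (by omega), tr, Equiv.swap_mul_self]
    have hd : deg m (sq m) = deg m (gen m 3 * gen m 3) := by
      rw [sq, map_mul, map_mul, deg_gen (by omega), deg_gen (by omega)]
    have h₁ : Commute (gen m 3 * gen m 3) (sq m) :=
      (gen_comm_sq (by omega)).mul_left (gen_comm_sq (by omega))
    have h₂ : Commute (gen m 1) (gen m 3 * gen m 3) :=
      (gen_comm (by omega)).mul_right (gen_comm (by omega))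
    have h₃ : Commute (gen m 1 * sq m * (gen m 1)⁻¹) (gen m 3 * gen m 3) :=
      (h₂.mul_left h₁.symm).mul_left h₂.inv_left
    exact commute_trans hπ (conj_sq_mem _) hz sq_mem (by rw [deg_conj, hd]) hd.symm (h₃.map π)
      (h₁.map π)
  · rw [gen_conj_sq h1]

end Commutation

section SmallCase

variable {m : ℕ} {G : Type*} [Group G]

lemma commute_sq_mul_left {a b : G} (h : a * b * a = b * a * b) :
    Commute (a * b * a * (a * b * a)) a := by
  have e : a * b * a * a = b * (a * b * a) :=
    (congrArg (· * a) h).trans (by simp only [mul_assoc])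
  have e' : a * b * a * b = a * (a * b * a) :=
    Eq.trans (by simp only [mul_assoc]) (congrArg (a * ·) h).symm
  rw [commute_iff_eq, mul_assoc, e, ← mul_assoc, e', mul_assoc]

lemma commute_sq_mul_right {a b : G} (h : a * b * a = b * a * b) :
    Commute (a * b * a * (a * b * a)) b := by
  rw [h]
  exact commute_sq_mul_left h.symm

lemma conj_sq_right {a b : G} (h : a * b * a = b * a * b) :
    b * (a * a) * b⁻¹ = (a * a)⁻¹ * (a * b * a * (a * b * a)) * (b * b)⁻¹ := by
  have e : a * b * a * b = a * (a * b * a) :=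
    Eq.trans (by simp only [mul_assoc]) (congrArg (a * ·) h).symm
  have : a * b * a * (a * b * a) = a * a * (b * (a * a) * b) := by
    nth_rw 2 [h]
    rw [← mul_assoc, ← mul_assoc]
    have e₂ : a * b * a * b * a * b = a * (a * b * a) * a * b := by rw [e]
    calc a * b * a * b * a * b = a * (a * b * a) * a * b := e₂
      _ = _ := by simp only [mul_assoc]
  rw [this]
  group

lemma conj_sq_left {a b : G} (h : a * b * a = b * a * b) :
    a * (b * b) * a⁻¹ = (b * b)⁻¹ * (a * b * a * (a * b * a)) * (a * a)⁻¹ := by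
  rw [h]
  exact conj_sq_right h.symm

/-- The square of the second generator. -/
def sqOne (m : ℕ) : BraidGroup (m + 2) := gen m 1 * gen m 1

/-- The commutator of the squares of the first two generators. -/
def kElt (m : ℕ) : BraidGroup (m + 2) := sqOne m * sq m * (sqOne m)⁻¹ * (sq m)⁻¹

/-- The conjugate of `kElt` by the square of the first generator. -/
def dElt (m : ℕ) : BraidGroup (m + 2) := sq m * kElt m * (sq m)⁻¹

lemma gen_sq_mem (i : ℕ) : gen m i * gen m i ∈ (perm m).ker := by
  rcases lt_or_ge i (m + 1) with h | h
  · rw [MonoidHom.mem_ker, map_mul, perm_gen h, tr, Equiv.swap_mul_self]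
  · rw [gen_of_le h, mul_one]
    exact one_mem _

lemma deg_gen_sq {i j : ℕ} (hi : i < m + 1) (hj : j < m + 1) :
    deg m (gen m i * gen m i) = deg m (gen m j * gen m j) := by
  rw [map_mul, map_mul, deg_gen hi, deg_gen hj]

lemma zeroPure_normal : (zeroPure m).Normal := by
  have := MonoidHom.normal_ker (deg m)
  have := MonoidHom.normal_ker (perm m)
  exact Subgroup.normal_inf_normal _ _

lemma kElt_mem : kElt m ∈ zeroPure m := by
  refine mem_inf.2 ⟨?_, ?_⟩
  · rw [MonoidHom.mem_ker, kElt, map_mul, map_mul, map_mul, map_inv, map_inv,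
      mul_comm (deg m (sqOne m)), mul_inv_cancel_right, mul_inv_cancel]
  · exact mul_mem (mul_mem (mul_mem (gen_sq_mem 1) sq_mem) (inv_mem (gen_sq_mem 1)))
      (inv_mem sq_mem)

lemma dElt_mem : dElt m ∈ zeroPure m := zeroPure_normal.conj_mem _ kElt_mem _

variable {π : BraidGroup (m + 2) →* G}

lemma commute_of_commute_inv_mul
    (hπ : ∀ a ∈ zeroPure m, ∀ b ∈ zeroPure m, Commute (π a) (π b))
    {p q c : BraidGroup (m + 2)} (hc : c ∈ (perm m).ker)
    (hp : p ∈ (perm m).ker) (hq : q ∈ (perm m).ker) (hd : deg m c = deg m (q ^ 3))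
    (hpq : deg m p = deg m q) (h : Commute (π c) (π (q⁻¹ * p))) :
    Commute (π q ^ 3) (π p) := by
  have hj := inv_mul_mem_zeroPure hq hp hpq.symm
  have e := conj_eq_conj hπ hc (pow_mem hq 3) hd hj
  rw [h.eq, mul_inv_cancel_right, eq_comm, mul_inv_eq_iff_eq_mul, map_pow] at e
  have e₁ : Commute (π q ^ 3) (π (q⁻¹ * p)) := e
  have e₂ : Commute (π q ^ 3) (π q) := (Commute.refl _).pow_left 3
  have := e₂.mul_right e₁
  rwa [← map_mul, mul_inv_cancel_left] at this

lemma kElt_mul_dElt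
    (hπ : ∀ a ∈ zeroPure m, ∀ b ∈ zeroPure m, Commute (π a) (π b))
    (hm : 1 ≤ m) :
    π (sq m) * π (dElt m) * (π (sq m))⁻¹ = (π (kElt m) * π (dElt m))⁻¹ := by
  have hb := gen_braid (m := m) (i := 0) (by omega)
  rw [zero_add] at hb
  have h₀ := commute_sq_mul_left hb
  have h₁ := commute_sq_mul_right hb
  set c := gen m 0 * gen m 1 * gen m 0 * (gen m 0 * gen m 1 * gen m 0) with hc
  have hx : Commute c (sq m) := h₀.mul_right h₀
  have hy : Commute c (sqOne m) := h₁.mul_right h₁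
  have hcp : c ∈ (perm m).ker := by
    have := conj_sq_right hb
    have : c = sq m * (gen m 1 * sq m * (gen m 1)⁻¹) * sqOne m := by
      rw [sq, this, sqOne, mul_assoc, inv_mul_cancel_right, mul_inv_cancel_left]
    rw [this]
    exact mul_mem (mul_mem sq_mem (conj_sq_mem _)) (gen_sq_mem 1)
  have hcd : deg m c = deg m (sq m ^ 3) := by
    rw [hc, sq]
    simp only [map_mul, map_pow]
    rw [deg_gen (show 1 < m + 1 by omega), deg_gen (show 0 < m + 1 by omega)]
    rfl
  have key := commute_of_commute_inv_mul hπ hcp (gen_sq_mem 1) sq_mem hcd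
    (deg_gen_sq (by omega) (by omega)) ((hx.inv_right.mul_right hy).map π)
  change Commute _ (π (sqOne m)) at key
  have h3 : π (kElt m) * π (dElt m) * (π (sq m) * π (dElt m) * (π (sq m))⁻¹) =
      π (sqOne m) * π (sq m) ^ 3 * (π (sqOne m))⁻¹ * (π (sq m) ^ 3)⁻¹ := by
    simp only [dElt, kElt, map_mul, map_inv, pow_succ, pow_zero]
    group
  rw [← key.eq, mul_inv_cancel_right, mul_inv_cancel] at h3
  exact eq_inv_of_mul_eq_one_right h3

lemma inv_conj_kElt
    (hπ : ∀ a ∈ zeroPure m, ∀ b ∈ zeroPure m, Commute (π a) (π b))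
    (hm : 1 ≤ m) :
    (π (sq m))⁻¹ * (π (kElt m))⁻¹ * π (sq m) = π (kElt m) * π (dElt m) := by
  have h := kElt_mul_dElt hπ hm
  have e : π (dElt m) = π (sq m) * π (kElt m) * (π (sq m))⁻¹ := by
    simp only [dElt, map_mul, map_inv]
  have : π (sq m) * (π (kElt m) * π (dElt m)) * (π (sq m))⁻¹ = (π (kElt m))⁻¹ := by
    calc _ = (π (sq m) * π (kElt m) * (π (sq m))⁻¹) * (π (sq m) * π (dElt m) * (π (sq m))⁻¹) := by
          group
      _ = _ := by
          rw [← e, h]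
          group
  rw [← this]
  group

/-- The action of the generators on the class of `kElt`. -/
lemma gen_conj_kElt
    (hπ : ∀ a ∈ zeroPure m, ∀ b ∈ zeroPure m, Commute (π a) (π b))
    (h1 : 1 ≤ m) (h2 : m ≤ 2) {i : ℕ} (hi : i < m + 1) :
    π (gen m i) * π (kElt m) * (π (gen m i))⁻¹ = π (kElt m) * π (dElt m) := by
  rw [← inv_conj_kElt hπ h1]
  have hb := gen_braid (m := m) (i := 0) (by omega)
  rw [zero_add] at hb
  have h₀ := commute_sq_mul_left hb
  have h₁ := commute_sq_mul_right hb
  have hY : ∀ j ∈ zeroPure m,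
      (π (sq m))⁻¹ * π j * π (sq m) = (π (sqOne m))⁻¹ * π j * π (sqOne m) := by
    intro j hj
    have := conj_eq_conj hπ (inv_mem (sq_mem (m := m))) (inv_mem (gen_sq_mem 1)) (by
      rw [map_inv, map_inv, sq, deg_gen_sq (i := 0) (j := 1) (by omega) (by omega)]) hj
    rwa [map_inv, map_inv, inv_inv, inv_inv] at this
  have hs : π (gen m i) * π (kElt m) * (π (gen m i))⁻¹ =
      π ((gen m i * sqOne m * (gen m i)⁻¹) * (gen m i * sq m * (gen m i)⁻¹) *
        (gen m i * sqOne m * (gen m i)⁻¹)⁻¹ * (gen m i * sq m * (gen m i)⁻¹)⁻¹) := by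
    rw [← map_mul, ← map_inv, ← map_mul, kElt]
    congr 1
    group
  have hend : (π (sqOne m))⁻¹ * π (sq m) * π (sqOne m) * (π (sq m))⁻¹ =
      (π (sq m))⁻¹ * (π (kElt m))⁻¹ * π (sq m) := by
    rw [← map_inv π (kElt m), hY _ (inv_mem kElt_mem)]
    simp only [kElt, map_mul, map_inv]
    group
  rw [hs]
  obtain rfl | rfl | rfl : i = 0 ∨ i = 1 ∨ i = 2 := by omega
  · rw [gen_conj_sq (by omega)]
    rw [sqOne, conj_sq_left hb, ← sqOne]
    rw [← hend, ← sq]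
    set c := gen m 0 * gen m 1 * gen m 0 * (gen m 0 * gen m 1 * gen m 0)
    have hx : Commute c (sq m) := h₀.mul_right h₀
    have : (sqOne m)⁻¹ * c * (sq m)⁻¹ * sq m * ((sqOne m)⁻¹ * c * (sq m)⁻¹)⁻¹ * (sq m)⁻¹ =
        (sqOne m)⁻¹ * (c * sq m * c⁻¹) * sqOne m * (sq m)⁻¹ := by group
    rw [this, hx.eq, mul_inv_cancel_right]
    simp only [map_mul, map_inv]
  · rw [sq, conj_sq_right hb, ← sq]
    set c := gen m 0 * gen m 1 * gen m 0 * (gen m 0 * gen m 1 * gen m 0)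
    have hy : Commute c (sqOne m) := h₁.mul_right h₁
    have e : gen m 1 * sqOne m * (gen m 1)⁻¹ = sqOne m := by rw [sqOne]; group
    rw [e]
    have : sqOne m * ((sq m)⁻¹ * c * (gen m 1 * gen m 1)⁻¹) * (sqOne m)⁻¹ *
        ((sq m)⁻¹ * c * (gen m 1 * gen m 1)⁻¹)⁻¹ =
        sqOne m * (sq m)⁻¹ * (c * (sqOne m)⁻¹ * c⁻¹) * sq m := by
      rw [← sqOne]
      group
    rw [this, hy.inv_right.eq, mul_inv_cancel_right]
    simp only [kElt, map_mul, map_inv]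
    group
  · rw [gen_conj_sq (by omega)]
    have hb' := gen_braid (m := m) (i := 1) (by omega)
    norm_num at hb'
    have k₂ := commute_sq_mul_right hb'
    rw [sqOne, conj_sq_right hb', ← sqOne]
    have hcp : gen m 1 * gen m 2 * gen m 1 * (gen m 1 * gen m 2 * gen m 1) ∈ (perm m).ker := by
      have : gen m 1 * gen m 2 * gen m 1 * (gen m 1 * gen m 2 * gen m 1) =
          sqOne m * (gen m 2 * sqOne m * (gen m 2)⁻¹) * (gen m 2 * gen m 2) := by
        rw [sqOne, conj_sq_right hb']
        group
      rw [this]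
      exact mul_mem (mul_mem (gen_sq_mem 1) ((MonoidHom.normal_ker _).conj_mem _ (gen_sq_mem 1) _))
        (gen_sq_mem 2)
    have hcd : deg m (gen m 1 * gen m 2 * gen m 1 * (gen m 1 * gen m 2 * gen m 1)) =
        deg m ((gen m 2 * gen m 2) ^ 3) := by
      simp only [map_mul, map_pow]
      rw [deg_gen (show 1 < m + 1 by omega), deg_gen (show 2 < m + 1 by omega)]
      rfl
    set c := gen m 1 * gen m 2 * gen m 1 * (gen m 1 * gen m 2 * gen m 1)
    set z := gen m 2 * gen m 2 with hz
    have hcz : Commute c z := k₂.mul_right k₂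
    have hzx : Commute z (sq m) := (gen_comm_sq (by omega)).mul_left (gen_comm_sq (by omega))
    have hn : z⁻¹ * sq m ∈ zeroPure m := inv_mul_mem_zeroPure (gen_sq_mem 2) sq_mem
      (deg_gen_sq (by omega) (by omega))
    have hcn : Commute (π c) (π (z⁻¹ * sq m)) := by
      have e := conj_eq_conj hπ hcp (pow_mem (gen_sq_mem 2) 3) hcd hn
      have : Commute (π (z ^ 3)) (π (z⁻¹ * sq m)) :=
        (((Commute.refl z).inv_right.mul_right hzx).pow_left 3).map π
      rw [← hz, this.eq, mul_inv_cancel_right, mul_inv_eq_iff_eq_mul] at e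
      exact e
    have hcx : Commute (π c) (π (sq m)) := by
      have := (hcz.map π).mul_right hcn
      rwa [← map_mul, mul_inv_cancel_left] at this
    rw [← hend]
    have : (sqOne m)⁻¹ * c * z⁻¹ * sq m * ((sqOne m)⁻¹ * c * z⁻¹)⁻¹ * (sq m)⁻¹ =
        (sqOne m)⁻¹ * (c * (z⁻¹ * sq m * z⁻¹⁻¹) * c⁻¹) * sqOne m * (sq m)⁻¹ := by group
    rw [this, hzx.inv_left.eq, mul_inv_cancel_right]
    simp only [map_mul, map_inv]
    rw [hcx.eq, mul_inv_cancel_right]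

lemma gen_conj_dElt
    (hπ : ∀ a ∈ zeroPure m, ∀ b ∈ zeroPure m, Commute (π a) (π b))
    (h1 : 1 ≤ m) (h2 : m ≤ 2) {i : ℕ} (hi : i < m + 1) :
    π (gen m i) * π (dElt m) * (π (gen m i))⁻¹ = (π (kElt m))⁻¹ := by
  have e : π (gen m i) * π (dElt m) * (π (gen m i))⁻¹ =
      π (gen m i * sq m * (gen m i)⁻¹) * π (gen m i * kElt m * (gen m i)⁻¹) *
        (π (gen m i * sq m * (gen m i)⁻¹))⁻¹ := by
    simp only [dElt, map_mul, map_inv]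
    group
  rw [e, conj_eq_conj hπ (conj_sq_mem _) sq_mem (deg_conj _ _)
    (zeroPure_normal.conj_mem _ kElt_mem _), map_mul, map_mul, map_inv, gen_conj_kElt hπ h1 h2 hi,
    ← inv_conj_kElt hπ h1]
  group

/-- For three or four strings, commutators of pure braids are products of powers of `kElt` and
`dElt`, modulo the commutator subgroup of the degree-zero pure braids. -/
lemma exists_zpow_mul_zpow
    (hπ : ∀ a ∈ zeroPure m, ∀ b ∈ zeroPure m, Commute (π a) (π b))
    (hs : Function.Surjective π) (h1 : 1 ≤ m) (h2 : m ≤ 2)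
    {p : BraidGroup (m + 2)} (hp : p ∈ ⁅(perm m).ker, (perm m).ker⁆) :
    ∃ a b : ℤ, π p = π (kElt m) ^ a * π (dElt m) ^ b := by
  have hKD : Commute (π (kElt m)) (π (dElt m)) := hπ _ kElt_mem _ dElt_mem
  have hk := fun {i} => gen_conj_kElt hπ h1 h2 (i := i)
  have hd := fun {i} => gen_conj_dElt hπ h1 h2 (i := i)
  set N : Subgroup G := closure {π (kElt m), π (dElt m)} with hN
  have hKN : π (kElt m) ∈ N := subset_closure (Or.inl rfl)
  have hDN : π (dElt m) ∈ N := subset_closure (Or.inr rfl)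
  have hgen : ∀ i < m + 1, ∀ n ∈ N, π (gen m i) * n * (π (gen m i))⁻¹ ∈ N := by
    intro i hi n hn
    have hle : N ≤ N.comap (MulAut.conj (π (gen m i))).toMonoidHom := by
      rw [hN, closure_le, ← hN]
      rintro _ (rfl | rfl)
      · change π (gen m i) * π (kElt m) * (π (gen m i))⁻¹ ∈ N
        rw [hk hi]
        exact mul_mem hKN hDN
      · change π (gen m i) * π (dElt m) * (π (gen m i))⁻¹ ∈ N
        rw [hd hi]
        exact inv_mem hKN
    exact hle hn
  have hgen' : ∀ i < m + 1, ∀ n ∈ N, (π (gen m i))⁻¹ * n * π (gen m i) ∈ N := by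
    intro i hi n hn
    have hle : N ≤ N.comap (MulAut.conj (π (gen m i))⁻¹).toMonoidHom := by
      rw [hN, closure_le, ← hN]
      rintro _ (rfl | rfl)
      · change (π (gen m i))⁻¹ * π (kElt m) * (π (gen m i))⁻¹⁻¹ ∈ N
        have : (π (gen m i))⁻¹ * π (kElt m) * (π (gen m i))⁻¹⁻¹ = (π (dElt m))⁻¹ := by
          rw [← inv_inv (π (kElt m)), ← hd hi]
          group
        rw [this]
        exact inv_mem hDN
      · change (π (gen m i))⁻¹ * π (dElt m) * (π (gen m i))⁻¹⁻¹ ∈ N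
        have : (π (gen m i))⁻¹ * π (dElt m) * (π (gen m i))⁻¹⁻¹ = π (dElt m) * π (kElt m) := by
          have e : π (dElt m) = π (gen m i) * π (dElt m) * (π (gen m i))⁻¹ *
              (π (gen m i) * π (kElt m) * (π (gen m i))⁻¹) := by
            rw [hk hi, hd hi, inv_mul_cancel_left]
          nth_rw 1 [e]
          group
        rw [this]
        exact mul_mem hDN hKN
    simpa using hle hn
  have hnorm : N.Normal := by
    refine ⟨fun n hn g => ?_⟩
    obtain ⟨g, rfl⟩ := hs g
    have hg : g ∈ closure (gen m '' {i | i < m + 1}) := by rw [closure_gen]; trivial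
    induction hg using closure_induction_left with
    | one => simpa using hn
    | mul_left x hx y _ ih =>
      obtain ⟨i, hi, rfl⟩ := hx
      convert! hgen i hi _ ih using 1
      rw [map_mul]
      group
    | inv_mul_cancel x hx y _ ih =>
      obtain ⟨i, hi, rfl⟩ := hx
      convert! hgen' i hi _ ih using 1
      rw [map_mul, map_inv]
      group
  have hcomm : ∀ p ∈ (perm m).ker, ∀ q ∈ (perm m).ker,
      Commute ((QuotientGroup.mk' N).comp π p) ((QuotientGroup.mk' N).comp π q) := by
    refine commute_of_gen_conj (fun a ha b hb => (hπ a ha b hb).map (QuotientGroup.mk' N)) ?_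
    intro i hi
    rcases eq_or_ne i 1 with rfl | hi1
    · have hb := gen_braid (m := m) (i := 0) (by omega)
      rw [zero_add] at hb
      have h₀ := commute_sq_mul_left hb
      have hc : Commute (gen m 0 * gen m 1 * gen m 0 * (gen m 0 * gen m 1 * gen m 0)) (sq m) :=
        h₀.mul_right h₀
      have hxy : Commute ((QuotientGroup.mk' N).comp π (sqOne m))
          ((QuotientGroup.mk' N).comp π (sq m)) := by
        have : (QuotientGroup.mk' N).comp π (kElt m) = 1 :=
          (QuotientGroup.eq_one_iff _).2 hKN
        rw [kElt, map_mul, map_mul, map_mul, map_inv, map_inv] at this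
        rwa [mul_inv_eq_one, mul_inv_eq_iff_eq_mul] at this
      rw [sq, conj_sq_right hb, ← sq, ← sqOne, map_mul, map_mul, map_inv, map_inv]
      exact ((Commute.refl _).inv_left.mul_left (hc.map _)).mul_left hxy.inv_left
    · rw [gen_conj_sq hi1]
  have hpN : π p ∈ N := by
    have hle : ⁅(perm m).ker, (perm m).ker⁆ ≤ ((QuotientGroup.mk' N).comp π).ker := by
      rw [commutator_le]
      intro a ha b hb
      rw [MonoidHom.mem_ker, map_commutatorElement, commutatorElement_eq_one_iff_commute]
      exact hcomm a ha b hb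
    exact (QuotientGroup.eq_one_iff _).1 (hle hp)
  clear hgen hgen' hnorm hcomm
  generalize π p = q at hpN
  induction hpN using closure_induction with
  | mem x hx =>
    rcases hx with rfl | rfl
    · exact ⟨1, 0, by simp⟩
    · exact ⟨0, 1, by simp⟩
  | one => exact ⟨0, 0, by simp⟩
  | mul x y _ _ hx hy =>
    obtain ⟨a, b, rfl⟩ := hx
    obtain ⟨c, d, rfl⟩ := hy
    refine ⟨a + c, b + d, ?_⟩
    rw [zpow_add, zpow_add, (hKD.zpow_zpow c b).symm.mul_mul_mul_comm]
  | inv x _ hx =>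
    obtain ⟨a, b, rfl⟩ := hx
    refine ⟨-a, -b, ?_⟩
    rw [mul_inv_rev, zpow_neg, zpow_neg, (hKD.zpow_zpow a b).inv_inv.eq]

end SmallCase

section Affine

variable {m : ℕ}

/-- The automorphism of order six of the rank two lattice. -/
def rot : MulAut (Multiplicative (ℤ × ℤ)) :=
  AddEquiv.toMultiplicative
    { toFun := fun v => (-v.2, v.1 + v.2)
      invFun := fun v => (v.1 + v.2, -v.1)
      left_inv := fun v => by simp
      right_inv := fun v => by simp
      map_add' := fun v w => by ext <;> simp <;> ring }

/-- The affine representation of the braid group on three or four strings on the rank two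
lattice. -/
def aff (hm : m ≤ 2) : BraidGroup (m + 2) →*
    Multiplicative (ℤ × ℤ) ⋊[zpowersHom _ rot] Multiplicative ℤ :=
  lift (fun i => ⟨Multiplicative.ofAdd (if i = 1 then (1, 0) else 0), Multiplicative.ofAdd 1⟩)
    (by
      intro i j hij hj
      obtain ⟨rfl, rfl⟩ : i = 0 ∧ j = 2 := by omega
      exact Commute.refl _)
    (by
      intro i hi
      obtain rfl | rfl : i = 0 ∨ i = 1 := by omega
      · decide +kernel
      · decide +kernel)

lemma aff_gen (hm : m ≤ 2) {i : ℕ} (hi : i < m + 1) : aff hm (gen m i) =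
    ⟨Multiplicative.ofAdd (if i = 1 then (1, 0) else 0), Multiplicative.ofAdd 1⟩ :=
  lift_gen _ _ _ hi

lemma aff_right (hm : m ≤ 2) (g : BraidGroup (m + 2)) : (aff hm g).right = deg m g := by
  have : SemidirectProduct.rightHom.comp (aff hm) = deg m := by
    refine hom_ext fun i hi => ?_
    rw [deg_gen hi, MonoidHom.comp_apply, aff_gen hm hi]
    rfl
  exact DFunLike.congr_fun this g

lemma aff_kElt (h1 : 1 ≤ m) (h2 : m ≤ 2) :
    aff h2 (kElt m) = SemidirectProduct.inl (Multiplicative.ofAdd (3, 0)) := by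
  simp only [kElt, sqOne, sq, map_mul, map_inv]
  rw [aff_gen h2 (show 0 < m + 1 by omega), aff_gen h2 (show 1 < m + 1 by omega)]
  refine SemidirectProduct.ext ?_ ?_ <;> decide +kernel

lemma aff_dElt (h1 : 1 ≤ m) (h2 : m ≤ 2) :
    aff h2 (dElt m) = SemidirectProduct.inl (Multiplicative.ofAdd (-3, 3)) := by
  simp only [dElt, sq, map_mul, map_inv]
  rw [aff_kElt h1 h2, aff_gen h2 (show 0 < m + 1 by omega)]
  refine SemidirectProduct.ext ?_ ?_ <;> decide +kernel

end Affine

section LinearAlgebra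

variable {M N : Type*} [AddCommGroup M] [AddCommGroup N]

lemma finrank_range_add_finrank_ker [Module.Finite ℤ M] (f : M →ₗ[ℤ] N) :
    Module.finrank ℤ f.range + Module.finrank ℤ f.ker = Module.finrank ℤ M := by
  rw [← f.quotKerEquivRange.finrank_eq, Submodule.finrank_quotient_add_finrank]

lemma finrank_inf_ker_add_one [Module.Finite ℤ M] (W : Submodule ℤ M) (f : M →ₗ[ℤ] ℤ)
    (h : ∃ w ∈ W, f w ≠ 0) :
    Module.finrank ℤ ↥(W ⊓ f.ker) + 1 = Module.finrank ℤ W := by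
  obtain ⟨w, hw, hfw⟩ := h
  rw [← finrank_range_add_finrank_ker (f.domRestrict W), add_comm]
  congr 1
  · refine le_antisymm (Nat.one_le_iff_ne_zero.2 (Nat.pos_iff_ne_zero.1 ?_)) ?_
    · rw [Module.finrank_pos_iff, Submodule.nontrivial_iff_ne_bot]
      intro e
      exact hfw ((Submodule.eq_bot_iff _).1 e _ ⟨⟨w, hw⟩, rfl⟩)
    · exact (Submodule.finrank_le _).trans (Module.finrank_self ℤ).le
  · rw [LinearMap.ker_domRestrict, ← Submodule.finrank_map_subtype_eq,
      Submodule.map_comap_subtype]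

variable {H : Type*} [Group H]

/-- The linear map on the abelianization given by a homomorphism to a commutative group. -/
def abLin (f : H →* Multiplicative N) : Additive (Abelianization H) →ₗ[ℤ] N :=
  (MonoidHom.toAdditiveLeft (Abelianization.lift f)).toIntLinearMap

lemma abLin_of (f : H →* Multiplicative N) (h : H) :
    abLin f (Additive.ofMul (Abelianization.of h)) = (f h).toAdd := rfl

lemma exists_of (v : Additive (Abelianization H)) :
    ∃ h : H, v = Additive.ofMul (Abelianization.of h) :=
  (QuotientGroup.mk_surjective (Additive.toMul v)).imp fun _ h => h.symm

lemma of_eq_zero {h : H} (hh : h ∈ commutator H) :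
    Additive.ofMul (Abelianization.of h) = (0 : Additive (Abelianization H)) := by
  rwa [← Abelianization.ker_of] at hh

/-- A finitely generated abelianization that embeds in a free abelian group is free. -/
lemma nonempty_mulEquiv [Module.Free ℤ N] [Module.Finite ℤ N]
    (f : Additive (Abelianization H) →ₗ[ℤ] N) (hf : Function.Injective f) {r : ℕ}
    (hr : Module.finrank ℤ (Additive (Abelianization H)) = r) :
    Nonempty (Abelianization H ≃* Multiplicative (Fin r → ℤ)) := by
  have : Module.Finite ℤ (Additive (Abelianization H)) := Module.Finite.of_injective f hf
  have : Module.Free ℤ (Additive (Abelianization H)) :=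
    Module.Free.of_equiv (LinearEquiv.ofInjective f hf).symm
  exact ⟨AddEquiv.toMultiplicativeRight
    (Module.finBasisOfFinrankEq ℤ _ hr).equivFun.toAddEquiv⟩

end LinearAlgebra

section Rank

variable {m : ℕ}

lemma exists_perm_map_eq {a : Sym2 (Fin (m + 2))} (ha : ¬ a.IsDiag) :
    ∃ τ : Equiv.Perm (Fin (m + 2)), s(pt m 0, pt m 1).map τ = a := by
  induction a with
  | _ u v =>
    rw [Sym2.mk_isDiag_iff] at ha
    have h01 : pt m 0 ≠ pt m 1 := pt_ne (by omega) (by omega) (by omega)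
    refine ⟨Equiv.swap (Equiv.swap (pt m 0) u (pt m 1)) v * Equiv.swap (pt m 0) u, ?_⟩
    rw [Sym2.map_mk, Equiv.Perm.mul_apply, Equiv.Perm.mul_apply, Equiv.swap_apply_left,
      Equiv.swap_apply_left, Equiv.swap_apply_of_ne_of_ne _ ha]
    nth_rw 1 [← Equiv.swap_apply_left (pt m 0) u]
    exact (Equiv.swap (pt m 0) u).injective.ne h01

/-- The lattice of winding numbers of pure braids. -/
def windLattice (m : ℕ) : Submodule ℤ (Sym2 (Fin (m + 2)) → ℤ) :=
  Submodule.span ℤ (Set.range fun a : {a : Sym2 (Fin (m + 2)) // ¬ a.IsDiag} =>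
    Pi.single (a : Sym2 (Fin (m + 2))) (2 : ℤ))

lemma finrank_windLattice : Module.finrank ℤ (windLattice m) = (m + 2).choose 2 := by
  rw [windLattice, finrank_span_eq_card, Sym2.card_subtype_not_diag, Fintype.card_fin]
  rw [Fintype.linearIndependent_iff]
  intro g hg a
  have := congrFun hg a
  simp only [Finset.sum_apply, Pi.smul_apply, Pi.single_apply, smul_eq_mul, mul_ite, mul_zero,
    Pi.zero_apply] at this
  rw [Finset.sum_eq_single a] at this
  · simpa using this
  · intro b _ hb
    exact if_neg fun e => hb (Subtype.ext e.symm)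
  · simp

/-- The sum of the entries. -/
def entrySum (m : ℕ) : (Sym2 (Fin (m + 2)) → ℤ) →ₗ[ℤ] ℤ := ∑ a, LinearMap.proj a

lemma entrySum_apply (v : Sym2 (Fin (m + 2)) → ℤ) : entrySum m v = ∑ a, v a := by
  simp [entrySum]

/-- The doubled winding numbers of a degree-zero pure braid. -/
def zeroWind (m : ℕ) : zeroPure m →* Multiplicative (Sym2 (Fin (m + 2)) → ℤ) :=
  (pureWind m).comp (inclusion inf_le_right)

lemma zeroWind_apply (p : zeroPure m) : zeroWind m p = (wind m p).left := rfl

lemma ofAdd_single_two (a : Sym2 (Fin (m + 2))) :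
    (Pi.single a 2 : Sym2 (Fin (m + 2)) → ℤ) = (pairInd a ^ 2).toAdd := by
  rw [pairInd, ← ofAdd_nsmul, toAdd_ofAdd, ← Pi.single_smul]
  rfl

lemma wind_mem_windLattice {p : BraidGroup (m + 2)} (hp : p ∈ (perm m).ker) :
    (wind m p).left.toAdd ∈ windLattice m := by
  have hle : (perm m).ker ≤
      ((AddSubgroup.toSubgroup (windLattice m).toAddSubgroup).comap (pureWind m)).map
        (perm m).ker.subtype := by
    refine ker_perm_le.trans ((closure_le _).2 ?_)
    rintro _ ⟨g, rfl⟩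
    refine ⟨⟨_, conj_sq_mem g⟩, ?_, rfl⟩
    change (wind m (g * sq m * g⁻¹)).left.toAdd ∈ windLattice m
    rw [wind_conj, ← ofAdd_single_two]
    refine Submodule.subset_span ⟨⟨_, ?_⟩, rfl⟩
    change ¬ s(perm m g (pt m 0), perm m g (pt m 1)).IsDiag
    rw [Sym2.mk_isDiag_iff]
    exact (perm m g).injective.ne (pt_ne (by omega) (by omega) (by omega))
  obtain ⟨q, hq, rfl⟩ := hle hp
  exact hq

lemma exists_wind_eq {v : Sym2 (Fin (m + 2)) → ℤ} (hv : v ∈ windLattice m) :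
    ∃ p ∈ (perm m).ker, (wind m p).left.toAdd = v := by
  have hle : windLattice m ≤ AddSubgroup.toIntSubmodule
      (Subgroup.toAddSubgroup' (pureWind m).range) := by
    refine Submodule.span_le.2 ?_
    rintro _ ⟨⟨a, ha⟩, rfl⟩
    obtain ⟨τ, rfl⟩ := exists_perm_map_eq ha
    obtain ⟨g, rfl⟩ := perm_surjective τ
    refine ⟨⟨_, conj_sq_mem g⟩, ?_⟩
    exact (wind_conj g).trans (congrArg Multiplicative.ofAdd (ofAdd_single_two _)).symm
  obtain ⟨p, hp⟩ := hle hv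
  exact ⟨p, p.2, hp⟩

lemma range_zeroWind : (abLin (zeroWind m)).range = windLattice m ⊓ (entrySum m).ker := by
  ext v
  rw [LinearMap.mem_range, Submodule.mem_inf, LinearMap.mem_ker, entrySum_apply]
  constructor
  · rintro ⟨q, rfl⟩
    obtain ⟨p, rfl⟩ := exists_of q
    rw [abLin_of, zeroWind_apply]
    refine ⟨wind_mem_windLattice (mem_inf.1 p.2).2, ?_⟩
    rw [sum_wind, MonoidHom.mem_ker.1 (mem_inf.1 p.2).1, toAdd_one]
  · rintro ⟨hv, hs⟩
    obtain ⟨p, hp, rfl⟩ := exists_wind_eq hv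
    rw [sum_wind] at hs
    exact ⟨Additive.ofMul (Abelianization.of ⟨p, mem_inf.2 ⟨hs, hp⟩⟩), rfl⟩

lemma finrank_range_zeroWind :
    Module.finrank ℤ (abLin (zeroWind m)).range = (m + 2).choose 2 - 1 := by
  rw [range_zeroWind, ← finrank_windLattice, ← finrank_inf_ker_add_one (windLattice m) (entrySum m),
    Nat.add_sub_cancel]
  refine ⟨Pi.single s(pt m 0, pt m 1) 2, Submodule.subset_span ⟨⟨_, ?_⟩, rfl⟩, ?_⟩
  · rw [Sym2.mk_isDiag_iff]
    exact pt_ne (by omega) (by omega) (by omega)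
  · rw [entrySum_apply]
    simp

instance : (zeroPure m).Normal := zeroPure_normal

lemma commute_mk (a : BraidGroup (m + 2)) (ha : a ∈ zeroPure m) (b : BraidGroup (m + 2))
    (hb : b ∈ zeroPure m) : Commute (QuotientGroup.mk' ⁅zeroPure m, zeroPure m⁆ a)
      (QuotientGroup.mk' ⁅zeroPure m, zeroPure m⁆ b) := by
  rw [← commutatorElement_eq_one_iff_commute, ← map_commutatorElement]
  exact (QuotientGroup.eq_one_iff _).2 (commutator_mem_commutator ha hb)

lemma mem_commutator_zeroPure {p : zeroPure m}
    (h : QuotientGroup.mk' ⁅zeroPure m, zeroPure m⁆ p = 1) : p ∈ commutator (zeroPure m) := by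
  have := (QuotientGroup.eq_one_iff _).1 h
  rw [← map_subtype_commutator] at this
  obtain ⟨q, hq, e⟩ := this
  rwa [← Subtype.ext e]

lemma zeroWind_injective (hm : m = 0 ∨ 3 ≤ m) : Function.Injective (abLin (zeroWind m)) := by
  rw [injective_iff_map_eq_zero]
  intro v hv
  obtain ⟨p, rfl⟩ := exists_of v
  refine of_eq_zero (mem_commutator_zeroPure ?_)
  have h := mem_commutator_of_wind (mem_inf.1 p.2).2 hv
  have hle : ⁅(perm m).ker, (perm m).ker⁆ ≤
      (QuotientGroup.mk' ⁅zeroPure m, zeroPure m⁆).ker := by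
    rw [commutator_le]
    intro a ha b hb
    rw [MonoidHom.mem_ker, map_commutatorElement, commutatorElement_eq_one_iff_commute]
    exact commute_of_ne commute_mk hm a ha b hb
  exact hle h

/-- The translation part of the affine representation on degree-zero pure braids. -/
def zeroAff (hm : m ≤ 2) : zeroPure m →* Multiplicative (ℤ × ℤ) where
  toFun g := (aff hm g).left
  map_one' := by simp
  map_mul' g h := by
    have : (aff hm g).right = 1 := (aff_right hm g).trans (mem_inf.1 g.2).1
    simp [this]

lemma zeroAff_kElt (h1 : 1 ≤ m) (h2 : m ≤ 2) :
    zeroAff h2 ⟨kElt m, kElt_mem⟩ = Multiplicative.ofAdd (3, 0) :=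
  congrArg SemidirectProduct.left (aff_kElt h1 h2)

lemma zeroAff_dElt (h1 : 1 ≤ m) (h2 : m ≤ 2) :
    zeroAff h2 ⟨dElt m, dElt_mem⟩ = Multiplicative.ofAdd (-3, 3) :=
  congrArg SemidirectProduct.left (aff_dElt h1 h2)

lemma zeroWind_kElt : zeroWind m ⟨kElt m, kElt_mem⟩ = 1 := by
  let x : (perm m).ker := ⟨sq m, sq_mem⟩
  let y : (perm m).ker := ⟨sqOne m, gen_sq_mem 1⟩
  change pureWind m (y * x * y⁻¹ * x⁻¹) = 1
  rw [map_mul, map_mul, map_mul, map_inv, map_inv, mul_comm (pureWind m y), mul_inv_cancel_right,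
    mul_inv_cancel]

lemma zeroWind_dElt : zeroWind m ⟨dElt m, dElt_mem⟩ = 1 := by
  let x : (perm m).ker := ⟨sq m, sq_mem⟩
  let k : (perm m).ker := ⟨kElt m, (mem_inf.1 kElt_mem).2⟩
  have hk : pureWind m k = 1 := zeroWind_kElt
  change pureWind m (x * k * x⁻¹) = 1
  rw [map_mul, map_mul, hk, mul_one, map_inv, mul_inv_cancel]

lemma eq_zero_of_zeroAff (h1 : 1 ≤ m) (h2 : m ≤ 2) {v : Additive (Abelianization (zeroPure m))}
    (hv : abLin (zeroWind m) v = 0) (hv' : abLin (zeroAff h2) v = 0) : v = 0 := by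
  obtain ⟨p, rfl⟩ := exists_of v
  have h := mem_commutator_of_wind (mem_inf.1 p.2).2 hv
  obtain ⟨a, b, hab⟩ := exists_zpow_mul_zpow commute_mk (QuotientGroup.mk'_surjective _) h1 h2 h
  let k : zeroPure m := ⟨kElt m, kElt_mem⟩
  let d : zeroPure m := ⟨dElt m, dElt_mem⟩
  have hp : p * (k ^ a * d ^ b)⁻¹ ∈ commutator (zeroPure m) := by
    refine mem_commutator_zeroPure ?_
    have e : ((p * (k ^ a * d ^ b)⁻¹ : zeroPure m) : BraidGroup (m + 2)) =
        p * (kElt m ^ a * dElt m ^ b)⁻¹ := rfl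
    rw [e, map_mul, map_inv, hab, map_mul, map_zpow, map_zpow, mul_inv_cancel]
  have hz : (zeroAff h2 (p * (k ^ a * d ^ b)⁻¹)).toAdd = 0 :=
    congrArg (abLin (zeroAff h2)) (of_eq_zero hp)
  have hv'' : zeroAff h2 p = 1 := hv'
  rw [map_mul (zeroAff h2), map_inv, hv'', map_mul (zeroAff h2), map_zpow, map_zpow,
    zeroAff_kElt h1, zeroAff_dElt h1, one_mul, toAdd_inv, neg_eq_zero, toAdd_mul, toAdd_zpow,
    toAdd_zpow, toAdd_ofAdd, toAdd_ofAdd] at hz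
  simp only [Prod.smul_mk, smul_eq_mul, Prod.mk_add_mk, Prod.mk_eq_zero] at hz
  obtain ⟨rfl, rfl⟩ : a = 0 ∧ b = 0 := by omega
  refine of_eq_zero ?_
  simpa using hp

lemma finrank_ker_zeroWind (h1 : 1 ≤ m) (h2 : m ≤ 2) :
    Module.finrank ℤ (abLin (zeroWind m)).ker = 2 := by
  let f := (abLin (zeroAff h2)).domRestrict (abLin (zeroWind m)).ker
  have hf : Function.Injective f := by
    rw [injective_iff_map_eq_zero]
    rintro ⟨v, hv⟩ hv'
    exact Subtype.ext (eq_zero_of_zeroAff h1 h2 hv hv')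
  have : Module.Finite ℤ (abLin (zeroWind m)).ker := Module.Finite.of_injective f hf
  refine le_antisymm ((LinearMap.finrank_le_finrank_of_injective hf).trans (by simp)) ?_
  let k : (abLin (zeroWind m)).ker := ⟨Additive.ofMul (Abelianization.of ⟨kElt m, kElt_mem⟩),
    congrArg Multiplicative.toAdd zeroWind_kElt⟩
  let d : (abLin (zeroWind m)).ker := ⟨Additive.ofMul (Abelianization.of ⟨dElt m, dElt_mem⟩),
    congrArg Multiplicative.toAdd zeroWind_dElt⟩
  have hli : LinearIndependent ℤ ![k, d] := by
    rw [LinearIndependent.pair_iff]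
    intro a b hab
    have e := congrArg f hab
    have hk : f k = (3, 0) := congrArg Multiplicative.toAdd (zeroAff_kElt h1 h2)
    have hd : f d = (-3, 3) := congrArg Multiplicative.toAdd (zeroAff_dElt h1 h2)
    rw [map_add, map_smul, map_smul, hk, hd, map_zero] at e
    simp only [Prod.smul_mk, smul_eq_mul, Prod.mk_add_mk, Prod.mk_eq_zero] at e
    omega
  simpa using hli.fintype_card_le_finrank

/-- The abelianization of the group of degree-zero pure braids. -/
lemma nonempty_abelianization_zeroPure (m : ℕ) :
    Nonempty (Abelianization (zeroPure m) ≃* Multiplicative (Fin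
      (if m + 2 = 3 ∨ m + 2 = 4 then (m + 2).choose 2 + 1 else (m + 2).choose 2 - 1) → ℤ)) := by
  by_cases h : m + 2 = 3 ∨ m + 2 = 4
  · have h1 : 1 ≤ m := by omega
    have h2 : m ≤ 2 := by omega
    have hinj : Function.Injective ((abLin (zeroWind m)).prod (abLin (zeroAff h2))) := by
      rw [injective_iff_map_eq_zero]
      intro v hv
      exact eq_zero_of_zeroAff h1 h2 (congrArg Prod.fst hv) (congrArg Prod.snd hv)
    have : Module.Finite ℤ (Additive (Abelianization (zeroPure m))) :=
      Module.Finite.of_injective _ hinj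
    refine nonempty_mulEquiv _ hinj ?_
    rw [if_pos h, ← finrank_range_add_finrank_ker (abLin (zeroWind m)), finrank_range_zeroWind,
      finrank_ker_zeroWind h1 h2]
    have : 0 < (m + 2).choose 2 := Nat.choose_pos (by omega)
    omega
  · have hinj := zeroWind_injective (m := m) (by omega)
    refine nonempty_mulEquiv _ hinj ?_
    rw [if_neg h, (LinearEquiv.ofInjective _ hinj).finrank_eq, finrank_range_zeroWind]

end Rank

end BraidJ

/-- For `n ≥ 2`, the abelianization of `J_n = B'_n ∩ P_n` is a free abelian group
of rank `C(n,2) + 1` if `n ∈ {3,4}` and of rank `C(n,2) - 1` otherwise. -/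
theorem Jn_abelianization_free (n : ℕ) (hn : 2 ≤ n)
    (μ : BraidGroup n →* Equiv.Perm (Fin n))
    (hμ : ∀ i : Fin (n - 1), μ (σ i) =
      Equiv.swap ⟨(i : ℕ), by have := i.isLt; omega⟩ ⟨(i : ℕ) + 1, by have := i.isLt; omega⟩) :
    Nonempty (Abelianization ↥(commutator (BraidGroup n) ⊓ μ.ker) ≃*
      Multiplicative (Fin (if n = 3 ∨ n = 4 then n.choose 2 + 1 else n.choose 2 - 1) → ℤ)) := by
  obtain ⟨m, rfl⟩ := Nat.exists_eq_add_of_le' hn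
  have hperm : μ = BraidJ.perm m := by
    refine BraidJ.hom_ext fun i hi => ?_
    rw [BraidJ.perm_gen hi, BraidJ.gen_of_lt hi, BraidJ.tr]
    refine (hμ _).trans ?_
    congr 1
    · exact Fin.ext (BraidJ.pt_val (by omega)).symm
    · exact Fin.ext (BraidJ.pt_val (by omega)).symm
  have e : commutator (BraidGroup (m + 2)) ⊓ μ.ker = BraidJ.zeroPure m := by
    rw [hperm, BraidJ.commutator_eq_ker_deg, BraidJ.zeroPure]
  rw [e]
  exact BraidJ.nonempty_abelianization_zeroPure m
end

section
/- Let u = σ_2σ_1^{−1} and t = σ_1^{−1}σ_2 in B_3; the elements ut, tu, u³, t³ all lie in J_3, and their images in the abelianization of J_3 form a free basis, i.e., the homomorphism ℤ⁴ → J_3^{ab} sending the standard basis vectors to the classes of ut, tu, u³, t³ is an isomorphism. -/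
/-- `u = σ₂σ₁⁻¹ ∈ B_3` (0-based generator indices). -/
def u3 : BraidGroup 3 := σ ⟨1, by omega⟩ * (σ ⟨0, by omega⟩)⁻¹

/-- `t = σ₁⁻¹σ₂ ∈ B_3` (0-based generator indices). -/
def t3 : BraidGroup 3 := (σ ⟨0, by omega⟩)⁻¹ * σ ⟨1, by omega⟩

namespace BraidThree

/-- The Artin generator `σ₁` of `B_3`. -/
def gen1 : BraidGroup 3 := σ ⟨0, by omega⟩

/-- The Artin generator `σ₂` of `B_3`. -/
def gen2 : BraidGroup 3 := σ ⟨1, by omega⟩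

theorem u3_eq : u3 = gen2 * gen1⁻¹ := rfl

theorem t3_eq : t3 = gen1⁻¹ * gen2 := rfl

theorem braid_relation : gen1 * gen2 * gen1 = gen2 * gen1 * gen2 := by
  have h := PresentedGroup.one_of_mem (rels := braidRels 3)
    (x := FreeGroup.of ⟨0, by omega⟩ * FreeGroup.of ⟨1, by omega⟩ * FreeGroup.of ⟨0, by omega⟩ *
      (FreeGroup.of ⟨1, by omega⟩ * FreeGroup.of ⟨0, by omega⟩ * FreeGroup.of ⟨1, by omega⟩)⁻¹)
    (Or.inr ⟨⟨0, by omega⟩, ⟨1, by omega⟩, rfl, rfl⟩)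
  rw [map_mul, map_inv, mul_inv_eq_one] at h
  exact h

theorem closure_gens : Subgroup.closure {gen1, gen2} = (⊤ : Subgroup (BraidGroup 3)) := by
  rw [← PresentedGroup.closure_range_of (braidRels 3)]
  congr 1
  ext x
  constructor
  · rintro (rfl | rfl)
    exacts [⟨⟨0, by omega⟩, rfl⟩, ⟨⟨1, by omega⟩, rfl⟩]
  · rintro ⟨i, rfl⟩
    fin_cases i
    exacts [Or.inl rfl, Or.inr rfl]

theorem gen1_conj_u3 : gen1 * u3 * gen1⁻¹ = t3⁻¹ * u3 := by
  have h : gen2⁻¹ * (gen1 * gen2 * gen1) = gen1 * gen2 := by rw [braid_relation]; group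
  calc gen1 * u3 * gen1⁻¹ = gen1 * gen2 * gen1⁻¹ * gen1⁻¹ := by rw [u3_eq]; group
    _ = t3⁻¹ * u3 := by rw [← h, u3_eq, t3_eq]; group

theorem gen1_conj_t3 : gen1 * t3 * gen1⁻¹ = u3 := by
  rw [u3_eq, t3_eq]; group

theorem gen1_inv_conj_u3 : gen1⁻¹ * u3 * gen1 = t3 := by
  rw [u3_eq, t3_eq]; group

theorem gen1_inv_conj_t3 : gen1⁻¹ * t3 * gen1 = t3 * u3⁻¹ := by
  have h := gen1_conj_u3
  calc gen1⁻¹ * t3 * gen1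
      = (gen1⁻¹ * u3 * gen1) * (gen1⁻¹ * (t3⁻¹ * u3) * gen1)⁻¹ := by group
    _ = t3 * u3⁻¹ := by rw [gen1_inv_conj_u3, ← h]; group

/-- The subgroup generated by `u` and `t`. -/
def utSubgroup : Subgroup (BraidGroup 3) := Subgroup.closure {u3, t3}

theorem u3_mem_utSubgroup : u3 ∈ utSubgroup := Subgroup.subset_closure (Or.inl rfl)

theorem t3_mem_utSubgroup : t3 ∈ utSubgroup := Subgroup.subset_closure (Or.inr rfl)

theorem utSubgroup_conj_mem {g : BraidGroup 3} (hu : g * u3 * g⁻¹ ∈ utSubgroup)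
    (ht : g * t3 * g⁻¹ ∈ utSubgroup) {f : BraidGroup 3} (hf : f ∈ utSubgroup) :
    g * f * g⁻¹ ∈ utSubgroup := by
  have : utSubgroup ≤ utSubgroup.comap (MulAut.conj g).toMonoidHom := by
    refine (Subgroup.closure_le _).2 ?_
    rintro x (rfl | rfl)
    exacts [hu, ht]
  exact this hf

instance utSubgroup_normal : utSubgroup.Normal := by
  have hu := u3_mem_utSubgroup
  have ht := t3_mem_utSubgroup
  have h1 : ∀ f ∈ utSubgroup, gen1 * f * gen1⁻¹ ∈ utSubgroup := fun f hf =>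
    utSubgroup_conj_mem (by rw [gen1_conj_u3]; exact mul_mem (inv_mem ht) hu)
      (by rwa [gen1_conj_t3]) hf
  have h1' : ∀ f ∈ utSubgroup, gen1⁻¹ * f * gen1 ∈ utSubgroup := fun f hf => by
    simpa using utSubgroup_conj_mem (g := gen1⁻¹) (by rwa [inv_inv, gen1_inv_conj_u3])
      (by rw [inv_inv, gen1_inv_conj_t3]; exact mul_mem ht (inv_mem hu)) hf
  have key : ∀ g : BraidGroup 3, ∀ f ∈ utSubgroup,
      g * f * g⁻¹ ∈ utSubgroup ∧ g⁻¹ * f * g ∈ utSubgroup := by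
    intro g
    have hg : g ∈ Subgroup.closure {gen1, gen2} := closure_gens ▸ Subgroup.mem_top g
    induction hg using Subgroup.closure_induction with
    | mem x hx =>
      intro f hf
      obtain rfl | rfl := hx
      · exact ⟨h1 f hf, h1' f hf⟩
      · have hb : gen2 = u3 * gen1 := by rw [u3_eq]; group
        rw [hb]
        constructor
        · simpa [mul_assoc] using mul_mem (mul_mem hu (h1 f hf)) (inv_mem hu)
        · simpa [mul_assoc] using h1' _ (mul_mem (mul_mem (inv_mem hu) hf) hu)
    | one => intro f hf; simpa using hf
    | mul x y _ _ hx hy =>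
      intro f hf
      exact ⟨by simpa [mul_assoc] using (hx _ (hy f hf).1).1,
        by simpa [mul_assoc] using (hy _ (hx f hf).2).2⟩
    | inv x _ hx => intro f hf; simpa using (hx f hf).symm
  exact ⟨fun f hf g => (key g f hf).1⟩

theorem commutator_le_utSubgroup : commutator (BraidGroup 3) ≤ utSubgroup := by
  let q := QuotientGroup.mk' utSubgroup
  have hq : q gen2 = q gen1 := by
    have : q u3 = 1 := (QuotientGroup.eq_one_iff _).2 u3_mem_utSubgroup
    rwa [u3_eq, map_mul, map_inv, mul_inv_eq_one] at this
  have hz : ∀ g, q g ∈ Subgroup.zpowers (q gen1) := by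
    have : Subgroup.closure {gen1, gen2} ≤ (Subgroup.zpowers (q gen1)).comap q := by
      refine (Subgroup.closure_le _).2 ?_
      rintro x (rfl | rfl)
      · exact Subgroup.mem_zpowers _
      · change q gen2 ∈ Subgroup.zpowers (q gen1)
        rw [hq]; exact Subgroup.mem_zpowers _
    rw [closure_gens] at this
    exact fun g => this (Subgroup.mem_top g)
  rw [commutator_def, Subgroup.commutator_le]
  intro g _ h _
  obtain ⟨m, hm⟩ := Subgroup.mem_zpowers_iff.1 (hz g)
  obtain ⟨n, hn⟩ := Subgroup.mem_zpowers_iff.1 (hz h)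
  refine (QuotientGroup.eq_one_iff _).1 ?_
  change q _ = 1
  rw [map_commutatorElement, ← hm, ← hn, commutatorElement_eq_one_iff_commute]
  exact (Commute.refl _).zpow_zpow m n

theorem abelianization_gens : Abelianization.of gen1 = Abelianization.of gen2 := by
  have h := congrArg Abelianization.of braid_relation
  simp only [map_mul] at h
  rw [mul_right_comm, mul_comm (Abelianization.of gen2)] at h
  rw [mul_right_comm, mul_assoc, mul_assoc] at h
  have h' := mul_left_cancel h
  rw [mul_comm] at h'
  exact mul_right_cancel h'

theorem u3_mem_commutator : u3 ∈ commutator (BraidGroup 3) := by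
  rw [← Abelianization.ker_of, MonoidHom.mem_ker, u3_eq, map_mul, map_inv, abelianization_gens,
    mul_inv_cancel]

theorem t3_mem_commutator : t3 ∈ commutator (BraidGroup 3) := by
  rw [← Abelianization.ker_of, MonoidHom.mem_ker, t3_eq, map_mul, map_inv, abelianization_gens,
    inv_mul_cancel]

section Generation

variable {G : Type*} [Group G] (u t : G)

/-- The subgroup generated by `ut`, `tu`, `u³` and `t³`. -/
def cubeSubgroup : Subgroup G := Subgroup.closure {u * t, t * u, u ^ 3, t ^ 3}

theorem mem_cosets_cubeSubgroup {f : G} (hf : f ∈ Subgroup.closure {u, t}) :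
    f ∈ cubeSubgroup u t ∨ u⁻¹ * f ∈ cubeSubgroup u t ∨ t⁻¹ * f ∈ cubeSubgroup u t := by
  have hx : u * t ∈ cubeSubgroup u t := Subgroup.subset_closure (by simp)
  have hy : t * u ∈ cubeSubgroup u t := Subgroup.subset_closure (by simp)
  have hU : u ^ 3 ∈ cubeSubgroup u t := Subgroup.subset_closure (by simp)
  have hT : t ^ 3 ∈ cubeSubgroup u t := Subgroup.subset_closure (by simp)
  induction hf using Subgroup.closure_induction_left with
  | one => exact Or.inl (one_mem _)
  | mul_left x hx' y _ ih =>
    obtain rfl | rfl := hx' <;> obtain h | h | h := ih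
    · right; left; simpa using h
    · right; right
      convert mul_mem (mul_mem (inv_mem hx) hU) h using 1; group
    · left
      convert mul_mem hx h using 1; group
    · right; right; simpa using h
    · left
      convert mul_mem hy h using 1; group
    · right; left
      convert mul_mem (mul_mem (inv_mem hy) hT) h using 1; group
  | inv_mul_cancel x hx' y _ ih =>
    obtain rfl | rfl := hx' <;> obtain h | h | h := ih
    · right; right
      convert mul_mem (inv_mem hx) h using 1; group
    · left; exact h
    · right; left
      convert mul_mem (mul_mem (inv_mem hU) hx) h using 1; group
    · right; left
      convert mul_mem (inv_mem hy) h using 1; group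
    · right; right
      convert mul_mem (mul_mem (inv_mem hT) hy) h using 1; group
    · left; exact h

end Generation

section Permutation

variable {μ : BraidGroup 3 →* Equiv.Perm (Fin 3)}

theorem cubeSubgroup_le (hu : μ u3 = finRotate 3 ^ 2) (ht : μ t3 = finRotate 3) :
    cubeSubgroup u3 t3 ≤ commutator (BraidGroup 3) ⊓ μ.ker := by
  have hu' := u3_mem_commutator
  have ht' := t3_mem_commutator
  refine (Subgroup.closure_le _).2 ?_
  rintro x (rfl | rfl | rfl | rfl)
  · exact ⟨mul_mem hu' ht', by
      change μ _ = 1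
      rw [map_mul, hu, ht]
      decide⟩
  · exact ⟨mul_mem ht' hu', by
      change μ _ = 1
      rw [map_mul, hu, ht]
      decide⟩
  · exact ⟨pow_mem hu' 3, by
      change μ _ = 1
      rw [map_pow, hu]
      decide⟩
  · exact ⟨pow_mem ht' 3, by
      change μ _ = 1
      rw [map_pow, ht]
      decide⟩

theorem le_cubeSubgroup (hu : μ u3 = finRotate 3 ^ 2) (ht : μ t3 = finRotate 3) :
    commutator (BraidGroup 3) ⊓ μ.ker ≤ cubeSubgroup u3 t3 := by
  rintro g ⟨hg, hμg⟩
  have hμg : μ g = 1 := hμg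
  have hker : ∀ x ∈ cubeSubgroup u3 t3, μ x = 1 := fun x hx => (cubeSubgroup_le hu ht hx).2
  obtain h | h | h := mem_cosets_cubeSubgroup u3 t3 (commutator_le_utSubgroup hg)
  · exact h
  · have := hker _ h
    rw [map_mul, map_inv, hμg, hu] at this
    exact absurd this (by decide)
  · have := hker _ h
    rw [map_mul, map_inv, hμg, ht] at this
    exact absurd this (by decide)

end Permutation

/-- The action of `σ₁` by conjugation on `F / [K, K]`, where `F` is free on `u, t` and `K` is the
kernel of the map `F → ℤ/3` sending `u` to `1` and `t` to `-1`; the pair `(i, v)` stands for the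
coset of `rᵢ k`, where `r₀ = 1`, `r₁ = u`, `r₂ = t` and `v` holds the coordinates of `k ∈ K` in the
basis `ut, tu, u³, t³` of `K / [K, K]`. -/
def gen1Perm : Equiv.Perm (Fin 3 × (Fin 4 → ℤ)) where
  toFun p := (-p.1, ![-p.2 0 + p.2 1, p.2 1, p.2 0 + p.2 2 + p.2 3, -p.2 1 - p.2 2] +
    (![0, ![0, 1, 0, -1], 0] : Fin 3 → Fin 4 → ℤ) p.1)
  invFun p :=
    let w := p.2 - (![0, ![0, 1, 0, -1], 0] : Fin 3 → Fin 4 → ℤ) (-p.1)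
    (-p.1, ![-w 0 + w 1, w 1, -w 1 - w 3, w 0 + w 2 + w 3])
  left_inv p := by
    ext j
    · simp
    · obtain ⟨i, v⟩ := p
      fin_cases i <;> fin_cases j <;> simp <;> ring
  right_inv p := by
    ext j
    · simp
    · obtain ⟨i, v⟩ := p
      fin_cases i <;> fin_cases j <;> simp <;> ring

/-- The action of `u` by left multiplication on the set described at `gen1Perm`. -/
def uPerm : Equiv.Perm (Fin 3 × (Fin 4 → ℤ)) where
  toFun p := (p.1 + 1, p.2 + (![0, ![-1, 0, 1, 0], ![1, 0, 0, 0]] : Fin 3 → Fin 4 → ℤ) p.1)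
  invFun p :=
    (p.1 - 1, p.2 - (![0, ![-1, 0, 1, 0], ![1, 0, 0, 0]] : Fin 3 → Fin 4 → ℤ) (p.1 - 1))
  left_inv p := by simp
  right_inv p := by simp

theorem fin_three_arith : (-1 : Fin 3) = 2 ∧ (-2 : Fin 3) = 1 ∧ (1 + 1 : Fin 3) = 2 ∧
    (1 + 2 : Fin 3) = 0 ∧ (2 + 1 : Fin 3) = 0 ∧ (2 + 2 : Fin 3) = 1 := by
  decide

theorem perm_braid_relation :
    gen1Perm * (uPerm * gen1Perm) * gen1Perm =
      (uPerm * gen1Perm) * gen1Perm * (uPerm * gen1Perm) := by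
  refine Equiv.ext ?_
  rintro ⟨i, v⟩
  refine Prod.ext ?_ (funext fun j => ?_)
  · simp [gen1Perm, uPerm]
    grind
  · fin_cases i <;> fin_cases j <;> simp [gen1Perm, uPerm, fin_three_arith] <;> ring

/-- The permutation representation of `B_3` on the set described at `gen1Perm`. -/
def permRep : BraidGroup 3 →* Equiv.Perm (Fin 3 × (Fin 4 → ℤ)) :=
  PresentedGroup.toGroup (f := ![gen1Perm, uPerm * gen1Perm]) <| by
    rintro r (⟨i, j, hij, rfl⟩ | ⟨i, j, hij, rfl⟩)
    · omega
    · obtain rfl : i = 0 := by ext; simp; omega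
      obtain rfl : j = 1 := by ext; simp; omega
      simp only [map_mul, map_inv, FreeGroup.lift_apply_of, mul_inv_eq_one]
      exact perm_braid_relation

theorem permRep_gen1 : permRep gen1 = gen1Perm := PresentedGroup.toGroup.of _

theorem permRep_gen2 : permRep gen2 = uPerm * gen1Perm := PresentedGroup.toGroup.of _

theorem permRep_u3 : permRep u3 = uPerm := by
  rw [u3_eq, map_mul, map_inv, permRep_gen1, permRep_gen2, mul_inv_cancel_right]

theorem permRep_t3 : permRep t3 = gen1Perm⁻¹ * uPerm * gen1Perm := by
  rw [t3_eq, map_mul, map_inv, permRep_gen1, permRep_gen2, mul_assoc]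

theorem permRep_u3_mul_t3 (v : Fin 4 → ℤ) :
    permRep (u3 * t3) (0, v) = (0, Pi.single 0 1 + v) := by
  rw [map_mul, permRep_u3, permRep_t3]
  refine Prod.ext (by simp [gen1Perm, uPerm, Equiv.Perm.inv_def, fin_three_arith])
    (funext fun j => ?_)
  fin_cases j <;> simp [gen1Perm, uPerm, Equiv.Perm.inv_def, fin_three_arith] <;> ring

theorem permRep_t3_mul_u3 (v : Fin 4 → ℤ) :
    permRep (t3 * u3) (0, v) = (0, Pi.single 1 1 + v) := by
  rw [map_mul, permRep_u3, permRep_t3]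
  refine Prod.ext (by simp [gen1Perm, uPerm, Equiv.Perm.inv_def, fin_three_arith])
    (funext fun j => ?_)
  fin_cases j <;> simp [gen1Perm, uPerm, Equiv.Perm.inv_def, fin_three_arith] <;> ring

theorem permRep_u3_pow (v : Fin 4 → ℤ) :
    permRep (u3 ^ 3) (0, v) = (0, Pi.single 2 1 + v) := by
  rw [map_pow, permRep_u3]
  refine Prod.ext (by simp [uPerm, pow_succ, fin_three_arith]) (funext fun j => ?_)
  fin_cases j <;> simp [uPerm, pow_succ, fin_three_arith, Matrix.vecHead, Matrix.vecTail, add_comm]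

theorem permRep_t3_pow (v : Fin 4 → ℤ) :
    permRep (t3 ^ 3) (0, v) = (0, Pi.single 3 1 + v) := by
  rw [map_pow, permRep_t3]
  refine Prod.ext (by simp [gen1Perm, uPerm, pow_succ, Equiv.Perm.inv_def, fin_three_arith])
    (funext fun j => ?_)
  fin_cases j <;> simp [gen1Perm, uPerm, pow_succ, Equiv.Perm.inv_def, fin_three_arith] <;> ring

theorem exists_permRep_eq {g : BraidGroup 3} (hg : g ∈ cubeSubgroup u3 t3) :
    ∃ w, ∀ v, permRep g (0, v) = (0, w + v) := by
  induction hg using Subgroup.closure_induction with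
  | mem x hx =>
    obtain rfl | rfl | rfl | rfl := hx
    exacts [⟨_, permRep_u3_mul_t3⟩, ⟨_, permRep_t3_mul_u3⟩, ⟨_, permRep_u3_pow⟩,
      ⟨_, permRep_t3_pow⟩]
  | one => exact ⟨0, fun v => by simp⟩
  | mul x y _ _ hx hy =>
    obtain ⟨a, ha⟩ := hx
    obtain ⟨b, hb⟩ := hy
    exact ⟨a + b, fun v => by rw [map_mul, Equiv.Perm.mul_apply, hb, ha, add_assoc]⟩
  | inv x _ hx =>
    obtain ⟨a, ha⟩ := hx
    exact ⟨-a, fun v => by rw [map_inv, Equiv.Perm.inv_eq_iff_eq, ha, add_neg_cancel_left]⟩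

/-- The coordinates of an element of a subgroup of `⟨ut, tu, u³, t³⟩`. -/
def coordinates {J : Subgroup (BraidGroup 3)} (hJ : J ≤ cubeSubgroup u3 t3) :
    J →* Multiplicative (Fin 4 → ℤ) where
  toFun g := Multiplicative.ofAdd (permRep g (0, 0)).2
  map_one' := by simp
  map_mul' g h := by
    obtain ⟨a, ha⟩ := exists_permRep_eq (hJ g.2)
    obtain ⟨b, hb⟩ := exists_permRep_eq (hJ h.2)
    simp [Equiv.Perm.mul_apply, ha, hb]

theorem coordinates_eq {J : Subgroup (BraidGroup 3)} (hJ : J ≤ cubeSubgroup u3 t3) {g : J}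
    {w : Fin 4 → ℤ} (hg : ∀ v, permRep g (0, v) = (0, w + v)) :
    coordinates hJ g = Multiplicative.ofAdd w := by
  simp [coordinates, hg]

end BraidThree

open BraidThree

/-- The elements `ut, tu, u³, t³` lie in `J_3 = B'_3 ∩ P_3`, and their classes form a
free basis of the abelianization of `J_3`: the homomorphism `ℤ⁴ → J_3^{ab}` sending the
standard basis vectors to these classes is an isomorphism. -/
theorem J3_abelianization_basis (μ : BraidGroup 3 →* Equiv.Perm (Fin 3))
    (hμ : ∀ i : Fin (3 - 1), μ (σ i) =
      Equiv.swap ⟨(i : ℕ), by have := i.isLt; omega⟩ ⟨(i : ℕ) + 1, by have := i.isLt; omega⟩) :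
    ∃ (h1 : u3 * t3 ∈ commutator (BraidGroup 3) ⊓ μ.ker)
      (h2 : t3 * u3 ∈ commutator (BraidGroup 3) ⊓ μ.ker)
      (h3 : u3 ^ 3 ∈ commutator (BraidGroup 3) ⊓ μ.ker)
      (h4 : t3 ^ 3 ∈ commutator (BraidGroup 3) ⊓ μ.ker),
      ∃ f : Multiplicative (Fin 4 → ℤ) →*
          Abelianization ↥(commutator (BraidGroup 3) ⊓ μ.ker),
        f (Multiplicative.ofAdd (Pi.single (0 : Fin 4) (1 : ℤ))) =
            Abelianization.of ⟨u3 * t3, h1⟩ ∧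
        f (Multiplicative.ofAdd (Pi.single (1 : Fin 4) (1 : ℤ))) =
            Abelianization.of ⟨t3 * u3, h2⟩ ∧
        f (Multiplicative.ofAdd (Pi.single (2 : Fin 4) (1 : ℤ))) =
            Abelianization.of ⟨u3 ^ 3, h3⟩ ∧
        f (Multiplicative.ofAdd (Pi.single (3 : Fin 4) (1 : ℤ))) =
            Abelianization.of ⟨t3 ^ 3, h4⟩ ∧
        Function.Bijective f := by
  have hu : μ u3 = finRotate 3 ^ 2 := by
    rw [u3, map_mul, map_inv, hμ, hμ]; decide
  have ht : μ t3 = finRotate 3 := by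
    rw [t3, map_mul, map_inv, hμ, hμ]; decide
  have hle := cubeSubgroup_le hu ht
  have hge := le_cubeSubgroup hu ht
  have h1 : u3 * t3 ∈ commutator (BraidGroup 3) ⊓ μ.ker :=
    hle (Subgroup.subset_closure (by simp))
  have h2 : t3 * u3 ∈ commutator (BraidGroup 3) ⊓ μ.ker :=
    hle (Subgroup.subset_closure (by simp))
  have h3 : u3 ^ 3 ∈ commutator (BraidGroup 3) ⊓ μ.ker :=
    hle (Subgroup.subset_closure (by simp))
  have h4 : t3 ^ 3 ∈ commutator (BraidGroup 3) ⊓ μ.ker :=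
    hle (Subgroup.subset_closure (by simp))
  let e : Fin 4 → Additive (Abelianization ↥(commutator (BraidGroup 3) ⊓ μ.ker)) :=
    fun i => Additive.ofMul (Abelianization.of (![⟨u3 * t3, h1⟩, ⟨t3 * u3, h2⟩,
      ⟨u3 ^ 3, h3⟩, ⟨t3 ^ 3, h4⟩] i))
  let f := AddMonoidHom.toMultiplicativeLeft
    (Fintype.linearCombination ℤ e).toAddMonoidHom
  have hf : ∀ i, f (Multiplicative.ofAdd (Pi.single i 1)) = (e i).toMul := fun i => by
    change Additive.toMul (Fintype.linearCombination ℤ e (Pi.single i 1)) = _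
    rw [Fintype.linearCombination_apply_single, one_smul]
  refine ⟨h1, h2, h3, h4, f, hf 0, hf 1, hf 2, hf 3, ?_, ?_⟩
  · let ψ := Abelianization.lift (coordinates hge)
    have hψ : (AddMonoidHom.toMultiplicative.symm (ψ.comp f)).toIntLinearMap =
        LinearMap.id := by
      refine LinearMap.pi_ext' fun i => LinearMap.ext_ring ?_
      change (ψ (f (Multiplicative.ofAdd (Pi.single i 1)))).toAdd = Pi.single i 1
      rw [hf, ← toAdd_ofAdd (Pi.single i 1 : Fin 4 → ℤ)]
      refine congrArg Multiplicative.toAdd ?_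
      refine (Abelianization.lift_apply_of _ _).trans (coordinates_eq hge ?_)
      fin_cases i
      exacts [permRep_u3_mul_t3, permRep_t3_mul_u3, permRep_u3_pow, permRep_t3_pow]
    exact Function.LeftInverse.injective (g := ψ) fun v => LinearMap.congr_fun hψ v
  · have key : ∀ g ∈ cubeSubgroup u3 t3, ∃ h : g ∈ commutator (BraidGroup 3) ⊓ μ.ker,
        Abelianization.of ⟨g, h⟩ ∈ f.range := by
      intro g hg
      induction hg using Subgroup.closure_induction with
      | mem x hx =>
        obtain rfl | rfl | rfl | rfl := hx
        exacts [⟨h1, _, hf 0⟩, ⟨h2, _, hf 1⟩, ⟨h3, _, hf 2⟩, ⟨h4, _, hf 3⟩]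
      | one => exact ⟨one_mem _, one_mem _⟩
      | mul x y _ _ hx hy =>
        obtain ⟨hx, hx'⟩ := hx
        obtain ⟨hy, hy'⟩ := hy
        exact ⟨mul_mem hx hy, mul_mem hx' hy'⟩
      | inv x _ hx =>
        obtain ⟨hx, hx'⟩ := hx
        exact ⟨inv_mem hx, inv_mem hx'⟩
    intro y
    obtain ⟨⟨g, hg⟩, rfl⟩ := QuotientGroup.mk_surjective y
    exact (key g (hge hg)).2
end
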